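/- Let n ≥ 1 and let u, v be probability densities on ℝⁿ such that (u dx, v dx) ∈ Π_𝒮, with Schrödinger decomposition u = f·T₁g, v = g·T₁f. Then liminf_{t→0⁺} (𝒜(u dx, T_t v dx) − 𝒜(u dx, v dx))/t ≥ −(1/2) · d/ds|_{s=1} H(μ_s|dx), where μ_s = T_s f·T_{1−s} g dx is the entropic interpolation between u dx and v dx. -/

import Mathlib

open MeasureTheory Filter Set
open scoped ENNReal NNReal

noncomputable section

abbrev Eucl (n : ℕ) : Type := EuclideanSpace ℝ (Fin n)

/-- Heat semigroup `T_t` on `ℝⁿ` (generator `Δ/2`), with `T_0 f = f`. -/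
noncomputable def heat (n : ℕ) (t : ℝ) (f : Eucl n → ℝ) (x : Eucl n) : ℝ :=
  if t = 0 then f x
  else ∫ y : Eucl n, f y * Real.exp (-‖x - y‖ ^ 2 / (2 * t)) / (2 * Real.pi * t) ^ ((n : ℝ) / 2)

/-- Relative entropy `H(ρ dx | dx) = ∫ ρ log ρ dx` of a density `ρ`. -/
noncomputable def entDens (n : ℕ) (ρ : Eucl n → ℝ) : ℝ :=
  ∫ x : Eucl n, ρ x * Real.log (ρ x)

/-- The measure `ρ dx`. -/
noncomputable def densMeas (n : ℕ) (ρ : Eucl n → ℝ) : Measure (Eucl n) :=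
  (volume : Measure (Eucl n)).withDensity fun x => ENNReal.ofReal (ρ x)

/-- The measure `R₀₁(dx dy) = e^{-|x-y|²/2} (2π)^{-n/2} dx dy` on `ℝⁿ × ℝⁿ`. -/
noncomputable def R01 (n : ℕ) : Measure (Eucl n × Eucl n) :=
  (volume : Measure (Eucl n × Eucl n)).withDensity fun p =>
    ENNReal.ofReal (Real.exp (-‖p.1 - p.2‖ ^ 2 / 2) / (2 * Real.pi) ^ ((n : ℝ) / 2))

open Classical in
/-- Relative entropy `H(p|r) = ∫ log (dp/dr) dp`, `+∞` if not absolutely continuous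
(or not integrable; the paper's definition requires an integrability condition as well). -/
noncomputable def relEnt {X : Type} [MeasurableSpace X] (p r : Measure X) : EReal :=
  if p ≪ r ∧ Integrable (fun x => Real.log (p.rnDeriv r x).toReal) p
  then ((∫ x, Real.log (p.rnDeriv r x).toReal ∂p : ℝ) : EReal) else ⊤

/-- `π` is a coupling of `μ0` and `μ1`. -/
def Coupling {X : Type} [MeasurableSpace X] (π : Measure (X × X)) (μ0 μ1 : Measure X) : Prop :=
  IsProbabilityMeasure π ∧ π.map Prod.fst = μ0 ∧ π.map Prod.snd = μ1

/-- Relative entropy of a measure with respect to Lebesgue, `∫ ρ log ρ` for the density `ρ`. -/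
noncomputable def entLeb (n : ℕ) (μ : Measure (Eucl n)) : ℝ :=
  ∫ x, (μ.rnDeriv volume x).toReal * Real.log ((μ.rnDeriv volume x).toReal)

/-- Entropic cost (EReal-valued):
`𝒜(μ0,μ1) = inf { H(π|R₀₁) } - (H(μ0|dx)+H(μ1|dx))/2`. -/
noncomputable def entCostE (n : ℕ) (μ0 μ1 : Measure (Eucl n)) : EReal :=
  (⨅ π : {π : Measure (Eucl n × Eucl n) // Coupling π μ0 μ1}, relEnt (π.1) (R01 n))
    - (((entLeb n μ0 + entLeb n μ1) / 2 : ℝ) : EReal)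

/-- Entropic cost, real-valued. -/
noncomputable def entCost (n : ℕ) (μ0 μ1 : Measure (Eucl n)) : ℝ :=
  (entCostE n μ0 μ1).toReal

/-- Squared quadratic Wasserstein distance. -/
noncomputable def W2sq (n : ℕ) (μ0 μ1 : Measure (Eucl n)) : ℝ :=
  (⨅ π : {π : Measure (Eucl n × Eucl n) // Coupling π μ0 μ1},
      ∫⁻ p, (‖p.1 - p.2‖₊ : ℝ≥0∞) ^ 2 ∂(π.1)).toReal

/-- `f` is (the function of) a Schwartz function. -/
def IsSchwartz (n : ℕ) (f : Eucl n → ℝ) : Prop :=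
  ∃ F : SchwartzMap (Eucl n) ℝ, ⇑F = f

/-- The pair `(μ0, μ1)` belongs to `Π_𝒮`: it admits a Schrödinger decomposition
`μ0 = f·T₁g dx`, `μ1 = g·T₁f dx` with `f, g` positive Schwartz functions bounded below
by a Gaussian. -/
def PiS (n : ℕ) (μ0 μ1 : Measure (Eucl n)) : Prop :=
  ∃ f g : Eucl n → ℝ, IsSchwartz n f ∧ IsSchwartz n g ∧
    (∀ x, 0 < f x) ∧ (∀ x, 0 < g x) ∧
    (∃ α c : ℝ, 0 < α ∧ 0 < c ∧ (∀ x, c * Real.exp (-α * ‖x‖ ^ 2) ≤ f x) ∧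
      (∀ x, c * Real.exp (-α * ‖x‖ ^ 2) ≤ g x)) ∧
    μ0 = densMeas n (fun x => f x * heat n 1 g x) ∧
    μ1 = densMeas n (fun x => g x * heat n 1 f x)

/-- Laplacian `Δφ = ∑ᵢ ∂²φ/∂xᵢ²`. -/
noncomputable def lap (n : ℕ) (φ : Eucl n → ℝ) (x : Eucl n) : ℝ :=
  ∑ i, fderiv ℝ (fun y => fderiv ℝ φ y (EuclideanSpace.single i 1)) x (EuclideanSpace.single i 1)

/-- Squared Hilbert-Schmidt norm of the Hessian, `‖Hess φ‖² = ∑ᵢⱼ (∂ᵢ∂ⱼφ)²`. -/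
noncomputable def hessHS (n : ℕ) (φ : Eucl n → ℝ) (x : Eucl n) : ℝ :=
  ∑ i, ∑ j, (fderiv ℝ (fun y => fderiv ℝ φ y (EuclideanSpace.single j 1)) x
    (EuclideanSpace.single i 1)) ^ 2

/-- Divergence `∇·F = ∑ᵢ ∂Fᵢ/∂xᵢ` of a vector field. -/
noncomputable def diverg (n : ℕ) (F : Eucl n → Eucl n) (x : Eucl n) : ℝ :=
  ∑ i, fderiv ℝ (fun y => F y i) x (EuclideanSpace.single i 1)

/-- Heat semigroup acting componentwise on vector-valued functions. -/
noncomputable def heatV (n : ℕ) (t : ℝ) (F : Eucl n → Eucl n) (x : Eucl n) : Eucl n :=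
  (EuclideanSpace.equiv (Fin n) ℝ).symm (fun i => heat n t (fun y => F y i) x)

/-- Entropic interpolation density `μ_s = T_s f · T_{1-s} g`. -/
noncomputable def entInterp (n : ℕ) (f g : Eucl n → ℝ) (s : ℝ) (x : Eucl n) : ℝ :=
  heat n s f x * heat n (1 - s) g x

/-- The potential `θ_s = (log T_{1-s} g - log T_s f)/2`, whose gradient drives the
transport equation of the entropic interpolation. -/
noncomputable def thetaPot (n : ℕ) (f g : Eucl n → ℝ) (s : ℝ) (x : Eucl n) : ℝ :=
  (Real.log (heat n (1 - s) g x) - Real.log (heat n s f x)) / 2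

end

namespace HeatFlow

noncomputable section

open ProbabilityTheory Topology

/-- The standard Gaussian density on `ℝⁿ`. -/
def gaussDens (n : ℕ) (z : Eucl n) : ℝ :=
  Real.exp (-‖z‖ ^ 2 / 2) / (2 * Real.pi) ^ ((n : ℝ) / 2)

/-- The standard Gaussian measure on `ℝⁿ`. -/
abbrev stdG (n : ℕ) : Measure (Eucl n) := stdGaussian (Eucl n)

/-- The heat semigroup written as a Gaussian average. -/
def gHeat {n : ℕ} {V : Type} [NormedAddCommGroup V] [NormedSpace ℝ V]
    (t : ℝ) (w : Eucl n → V) (x : Eucl n) : V :=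
  ∫ z, w (x + √t • z) ∂stdG n

/-- Polynomially decaying weight. -/
def wt {n : ℕ} (N : ℕ) (x : Eucl n) : ℝ := ((1 + ‖x‖) ^ N)⁻¹

lemma gaussDens_pos (n : ℕ) (z : Eucl n) : 0 < gaussDens n z := by
  unfold gaussDens; positivity

lemma continuous_gaussDens (n : ℕ) : Continuous (gaussDens n) := by
  unfold gaussDens; fun_prop

lemma integral_gaussDens (n : ℕ) : ∫ z, gaussDens n z = 1 := by
  have h := GaussianFourier.integral_rexp_neg_mul_sq_norm (V := Eucl n) (b := 1 / 2) (by norm_num)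
  have h2 : ∀ z : Eucl n, gaussDens n z
      = Real.exp (-(1 / 2) * ‖z‖ ^ 2) * ((2 * Real.pi) ^ ((n : ℝ) / 2))⁻¹ := by
    intro z
    rw [gaussDens, div_eq_mul_inv]
    congr 2; ring
  simp_rw [h2]
  rw [integral_mul_const, h, finrank_euclideanSpace_fin,
    show Real.pi / (1 / 2) = 2 * Real.pi by ring]
  exact mul_inv_cancel₀ (by positivity)

lemma integrable_gaussDens (n : ℕ) : Integrable (gaussDens n) := by
  by_contra h
  have := integral_gaussDens n
  rw [integral_undef h] at this
  exact zero_ne_one this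

lemma stdG_eq (n : ℕ) :
    stdG n = volume.withDensity (fun z => ENNReal.ofReal (gaussDens n z)) := by
  have hfin : IsFiniteMeasure
      ((volume : Measure (Eucl n)).withDensity fun z => ENNReal.ofReal (gaussDens n z)) :=
    isFiniteMeasure_withDensity_ofReal (integrable_gaussDens n).2
  apply Measure.ext_of_charFun
  ext t
  rw [charFun_stdGaussian, charFun_apply,
    integral_withDensity_eq_integral_toReal_smul
      (by have := (continuous_gaussDens n).measurable; fun_prop) (by simp)]
  have h := GaussianFourier.integral_cexp_neg_mul_sq_norm_add (V := Eucl n) (b := 1 / 2)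
    (by norm_num) Complex.I t
  have hc : ((2 * Real.pi : ℂ)) ^ ((n : ℂ) / 2) = (((2 * Real.pi) ^ ((n : ℝ) / 2) : ℝ) : ℂ) := by
    rw [Complex.ofReal_cpow (by positivity)]; push_cast; rfl
  have h2 : ∀ z : Eucl n, (ENNReal.ofReal (gaussDens n z)).toReal
        • Complex.exp ((inner ℝ z t : ℝ) * Complex.I)
      = ((2 * Real.pi : ℂ) ^ ((n : ℂ) / 2))⁻¹
        * Complex.exp (-(1 / 2) * ‖z‖ ^ 2 + Complex.I * (inner ℝ t z : ℝ)) := by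
    intro z
    rw [ENNReal.toReal_ofReal (gaussDens_pos n z).le, hc, gaussDens, Complex.exp_add,
      real_inner_comm, Complex.real_smul]
    push_cast
    rw [show -(‖z‖ : ℂ) ^ 2 / 2 = -(1 / 2) * ‖z‖ ^ 2 by ring,
      mul_comm Complex.I]
    ring
  simp_rw [h2]
  rw [integral_const_mul, h, finrank_euclideanSpace_fin,
    show (Real.pi / (1 / 2) : ℂ) = 2 * Real.pi by ring, ← mul_assoc, inv_mul_cancel₀, one_mul]
  · rw [Complex.I_sq]
    congr 1; ring
  · rw [hc]
    exact_mod_cast (by positivity : (0 : ℝ) < (2 * Real.pi) ^ ((n : ℝ) / 2)).ne'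

lemma integral_stdG {n : ℕ} {V : Type*} [NormedAddCommGroup V] [NormedSpace ℝ V]
    (h : Eucl n → V) : ∫ z, h z ∂stdG n = ∫ z, gaussDens n z • h z := by
  rw [stdG_eq, integral_withDensity_eq_integral_toReal_smul
      (by have := (continuous_gaussDens n).measurable; fun_prop) (by simp)]
  simp_rw [ENNReal.toReal_ofReal (gaussDens_pos n _).le]

lemma heat_eq_gHeat {n : ℕ} {t : ℝ} (ht : 0 ≤ t) (w : Eucl n → ℝ) (x : Eucl n) :
    heat n t w x = gHeat t w x := by
  rcases ht.eq_or_lt with rfl | ht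
  · simp [heat, gHeat]
  have hs : 0 < √t := Real.sqrt_pos.2 ht
  rw [heat, if_neg ht.ne', gHeat, integral_stdG]
  have h1 := Measure.integral_comp_smul (volume : Measure (Eucl n))
    (fun y => (w (x + y) * Real.exp (-‖y‖ ^ 2 / (2 * t)) / (2 * Real.pi * t) ^ ((n : ℝ) / 2))) (√t)
  rw [finrank_euclideanSpace_fin] at h1
  have h2 : ∫ y : Eucl n, w y * Real.exp (-‖x - y‖ ^ 2 / (2 * t))
        / (2 * Real.pi * t) ^ ((n : ℝ) / 2)
      = ∫ y : Eucl n, w (x + y) * Real.exp (-‖y‖ ^ 2 / (2 * t))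
        / (2 * Real.pi * t) ^ ((n : ℝ) / 2) := by
    rw [← integral_add_left_eq_self _ x]
    simp
  have hpow : t ^ ((n : ℝ) / 2) = (√t) ^ n := by
    rw [Real.sqrt_eq_rpow, ← Real.rpow_natCast, ← Real.rpow_mul ht.le]
    congr 1; ring
  have h3 : ∀ z : Eucl n, gaussDens n z • w (x + √t • z)
      = (√t) ^ n * (w (x + √t • z) * Real.exp (-‖√t • z‖ ^ 2 / (2 * t))
        / (2 * Real.pi * t) ^ ((n : ℝ) / 2)) := by
    intro z
    rw [gaussDens, norm_smul, mul_pow, Real.norm_of_nonneg hs.le, Real.sq_sqrt ht.le,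
      Real.mul_rpow (by positivity) ht.le, hpow, smul_eq_mul]
    have : -(t * ‖z‖ ^ 2) / (2 * t) = -‖z‖ ^ 2 / 2 := by field_simp
    rw [this]
    field_simp
  simp_rw [h3]
  rw [integral_const_mul, h1, h2, abs_of_pos (by positivity), smul_eq_mul, ← mul_assoc,
    mul_inv_cancel₀ (by positivity), one_mul]

lemma integrable_one_add_norm_pow_stdG (n k : ℕ) :
    Integrable (fun z : Eucl n => (1 + ‖z‖) ^ k) (stdG n) := by
  have h0 : MemLp (fun z : Eucl n => ‖z‖) k (stdG n) :=
    MemLp.norm (f := id) (IsGaussian.memLp_id (stdG n) k (by simp))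
  have h1 : MemLp (fun _ : Eucl n => (1 : ℝ)) k (stdG n) := memLp_const 1
  have h : MemLp (fun z : Eucl n => 1 + ‖z‖) k (stdG n) := h1.add h0
  refine (h.integrable_norm_pow').congr (ae_of_all _ fun z => ?_)
  simp only
  rw [Real.norm_of_nonneg (by positivity)]

lemma integral_clm_stdG {n : ℕ} (L : Eucl n →L[ℝ] ℝ) : ∫ z, L z ∂stdG n = 0 :=
  integral_strongDual_stdGaussian L

lemma wt_pos {n : ℕ} (N : ℕ) (x : Eucl n) : 0 < wt N x := by unfold wt; positivity

lemma wt_le_one {n : ℕ} (N : ℕ) (x : Eucl n) : wt N x ≤ 1 := by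
  unfold wt
  exact inv_le_one_of_one_le₀ (one_le_pow₀ (by linarith [norm_nonneg x]))

lemma wt_mul_pow {n : ℕ} (N k : ℕ) (x : Eucl n) : wt (N + k) x * (1 + ‖x‖) ^ k = wt N x := by
  unfold wt
  have : (0 : ℝ) < 1 + ‖x‖ := by positivity
  field_simp
  ring

lemma wt_add_le {n : ℕ} (N : ℕ) (x h : Eucl n) : wt N (x + h) ≤ (1 + ‖h‖) ^ N * wt N x := by
  unfold wt
  rw [← div_eq_mul_inv, ← one_div, div_le_div_iff₀ (by positivity) (by positivity), one_mul,
    ← mul_pow]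
  have h1 : ‖x‖ ≤ ‖x + h‖ + ‖h‖ := by
    calc ‖x‖ = ‖(x + h) - h‖ := by simp
      _ ≤ _ := norm_sub_le _ _
  gcongr
  nlinarith [norm_nonneg (x + h), norm_nonneg h, mul_nonneg (norm_nonneg h) (norm_nonneg (x + h))]

lemma integrable_wt {n : ℕ} (N : ℕ) (hN : n < N) : Integrable (wt N : Eucl n → ℝ) := by
  have h := integrable_one_add_norm (E := Eucl n) (μ := volume) (r := N)
    (by rw [finrank_euclideanSpace_fin]; exact_mod_cast hN)
  refine h.congr (ae_of_all _ fun x => ?_)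
  simp only [wt]
  rw [Real.rpow_neg (by positivity), Real.rpow_natCast]

lemma schwartz_decay {n : ℕ} {V : Type} [NormedAddCommGroup V] [NormedSpace ℝ V]
    (F : SchwartzMap (Eucl n) V) (N : ℕ) : ∃ C, 0 ≤ C ∧ ∀ x, ‖F x‖ ≤ C * wt N x := by
  have h := SchwartzMap.one_add_le_sup_seminorm_apply (𝕜 := ℝ) (m := (N, 0)) (k := N) (n := 0)
    le_rfl le_rfl F
  refine ⟨_, le_trans (by positivity) (h 0), fun x => ?_⟩
  have hx := h x
  rw [norm_iteratedFDeriv_zero] at hx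
  unfold wt
  rw [← div_eq_mul_inv, le_div_iff₀ (by positivity), mul_comm]
  exact hx

/-- The heat semigroup composition law, in Gaussian form. -/
lemma gHeat_gHeat {n : ℕ} {s t : ℝ} (hs : 0 ≤ s) (ht : 0 ≤ t) {w : Eucl n → ℝ}
    (hw : Continuous w) {C : ℝ} (hC : ∀ x, |w x| ≤ C) (x : Eucl n) :
    gHeat s (gHeat t w) x = gHeat (s + t) w x := by
  have hm : ((stdG n).map (√s • ·)).conv ((stdG n).map (√t • ·))
      = (stdG n).map (√(s + t) • ·) := by
    have i1 : IsProbabilityMeasure ((stdG n).map (√s • ·)) :=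
      Measure.isProbabilityMeasure_map (by fun_prop)
    have i2 : IsProbabilityMeasure ((stdG n).map (√t • ·)) :=
      Measure.isProbabilityMeasure_map (by fun_prop)
    have i3 : IsProbabilityMeasure ((stdG n).map (√(s + t) • ·)) :=
      Measure.isProbabilityMeasure_map (by fun_prop)
    apply Measure.ext_of_charFun
    ext r
    rw [charFun_conv, charFun_map_smul, charFun_map_smul, charFun_map_smul, charFun_stdGaussian,
      charFun_stdGaussian, charFun_stdGaussian, ← Complex.exp_add]
    congr 1
    simp only [norm_smul, Real.norm_of_nonneg (Real.sqrt_nonneg _)]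
    norm_cast
    simp only [mul_pow, Real.sq_sqrt hs, Real.sq_sqrt ht, Real.sq_sqrt (add_nonneg hs ht)]
    ring
  have h1 : gHeat (s + t) w x = ∫ y, w (x + y) ∂((stdG n).map (√(s + t) • ·)) := by
    rw [integral_map (by fun_prop)
      (by exact (hw.comp (continuous_const.add continuous_id)).aestronglyMeasurable), gHeat]
  rw [h1, ← hm, Measure.conv, integral_map (by fun_prop)
    (by exact (hw.comp (continuous_const.add continuous_id)).aestronglyMeasurable),
    Measure.map_prod_map (stdG n) (stdG n) (f := fun z => √s • z) (g := fun z => √t • z)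
      (by fun_prop) (by fun_prop), integral_map (by fun_prop)
    (by exact (hw.comp (by fun_prop)).aestronglyMeasurable)]
  have hint : Integrable (fun p : Eucl n × Eucl n => w (x + (√s • p.1 + √t • p.2)))
      ((stdG n).prod (stdG n)) :=
    Integrable.of_bound (hw.comp (by fun_prop)).aestronglyMeasurable C
      (ae_of_all _ fun p => hC _)
  rw [show (∫ z, w (x + ((Prod.map (√s • ·) (√t • ·) z).1 + (Prod.map (√s • ·) (√t • ·) z).2))
      ∂(stdG n).prod (stdG n))
    = ∫ p : Eucl n × Eucl n, w (x + (√s • p.1 + √t • p.2)) ∂(stdG n).prod (stdG n) from rfl,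
    integral_prod _ hint]
  simp only [gHeat, add_assoc]

section Schwartz

variable {n : ℕ} {V : Type} [NormedAddCommGroup V] [NormedSpace ℝ V]

lemma integrable_schwartz_comp_stdG (F : SchwartzMap (Eucl n) V) (t : ℝ) (x : Eucl n) :
    Integrable (fun z => F (x + √t • z)) (stdG n) := by
  obtain ⟨C, hC, h⟩ := schwartz_decay F 0
  refine Integrable.of_bound (F.continuous.comp (by fun_prop)).aestronglyMeasurable C
    (ae_of_all _ fun z => ?_)
  simpa [wt] using h (x + √t • z)

lemma norm_sqrt_smul_le {t : ℝ} (ht : t ≤ 1) (z : Eucl n) : ‖√t • z‖ ≤ ‖z‖ := by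
  rw [norm_smul, Real.norm_of_nonneg (Real.sqrt_nonneg _)]
  exact mul_le_of_le_one_left (norm_nonneg _) (Real.sqrt_le_one.2 ht)

lemma wt_add_sqrt_smul_le (N : ℕ) {t : ℝ} (ht : t ≤ 1) (x z : Eucl n) :
    wt N (x + √t • z) ≤ (1 + ‖z‖) ^ N * wt N x := by
  refine (wt_add_le N x _).trans ?_
  have := norm_sqrt_smul_le ht z
  have := (wt_pos N x).le
  gcongr

lemma gHeat_decay (F : SchwartzMap (Eucl n) V) (N : ℕ) :
    ∃ C, 0 ≤ C ∧ ∀ t ≤ 1, ∀ x, ‖gHeat t F x‖ ≤ C * wt N x := by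
  obtain ⟨C, hC, h⟩ := schwartz_decay F N
  refine ⟨C * ∫ z, (1 + ‖z‖) ^ N ∂stdG n, by positivity, fun t ht x => ?_⟩
  have hb : ∀ z, ‖F (x + √t • z)‖ ≤ C * wt N x * (1 + ‖z‖) ^ N := fun z =>
    (h _).trans <| by
      have := wt_add_sqrt_smul_le N ht x z
      calc C * wt N (x + √t • z) ≤ C * ((1 + ‖z‖) ^ N * wt N x) := by gcongr
        _ = _ := by ring
  refine (norm_integral_le_of_norm_le
    ((integrable_one_add_norm_pow_stdG n N).const_mul (C * wt N x))
    (ae_of_all _ hb)).trans_eq ?_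
  rw [integral_const_mul]; ring

lemma hasFDerivAt_gHeat (F : SchwartzMap (Eucl n) V) (t : ℝ) (x : Eucl n) :
    HasFDerivAt (gHeat t F) (gHeat t (SchwartzMap.fderivCLM ℝ (Eucl n) V F) x) x := by
  obtain ⟨C, hC, h⟩ := schwartz_decay (SchwartzMap.fderivCLM ℝ (Eucl n) V F) 0
  refine hasFDerivAt_integral_of_dominated_of_fderiv_le (bound := fun _ => C) (s := univ)
    Filter.univ_mem
    (Eventually.of_forall fun y => (integrable_schwartz_comp_stdG F t y).1)
    (integrable_schwartz_comp_stdG F t x)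
    (integrable_schwartz_comp_stdG (SchwartzMap.fderivCLM ℝ (Eucl n) V F) t x).1
    (ae_of_all _ fun z y _ => by simpa [wt] using h (y + √t • z)) (integrable_const C)
    (ae_of_all _ fun z y _ => ?_)
  exact (hasFDerivAt_comp_add_right (√t • z)).2
    (F.differentiableAt (x := y + √t • z)).hasFDerivAt

lemma gHeat_contDiff_decay {t : ℝ} (ht : t ≤ 1) (k : ℕ) :
    ∀ {V : Type} [NormedAddCommGroup V] [NormedSpace ℝ V] (F : SchwartzMap (Eucl n) V),
      ContDiff ℝ k (gHeat t F) ∧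
      ∀ N, ∃ C, ∀ x, ‖iteratedFDeriv ℝ k (gHeat t F) x‖ ≤ C * wt N x := by
  induction k with
  | zero =>
    intro V _ _ F
    refine ⟨contDiff_zero.2 (continuous_iff_continuousAt.2 fun x =>
      (hasFDerivAt_gHeat F t x).continuousAt), fun N => ?_⟩
    obtain ⟨C, -, h⟩ := gHeat_decay F N
    exact ⟨C, fun x => by rw [norm_iteratedFDeriv_zero]; exact h t ht x⟩
  | succ k ih =>
    intro V _ _ F
    have hfd : fderiv ℝ (gHeat t F) = gHeat t (SchwartzMap.fderivCLM ℝ (Eucl n) V F) :=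
      funext fun x => (hasFDerivAt_gHeat F t x).fderiv
    obtain ⟨h1, h2⟩ := ih (SchwartzMap.fderivCLM ℝ (Eucl n) V F)
    refine ⟨?_, fun N => ?_⟩
    · have : ((k + 1 : ℕ) : WithTop ℕ∞) = (k : WithTop ℕ∞) + 1 := by push_cast; rfl
      rw [this, contDiff_succ_iff_fderiv]
      exact ⟨fun x => (hasFDerivAt_gHeat F t x).differentiableAt, by simp, hfd ▸ h1⟩
    · obtain ⟨C, h⟩ := h2 N
      refine ⟨C, fun x => ?_⟩
      rw [← norm_iteratedFDeriv_fderiv, hfd]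
      exact h x

lemma exists_schwartz_gHeat {t : ℝ} (ht : t ≤ 1) (F : SchwartzMap (Eucl n) V) :
    ∃ G : SchwartzMap (Eucl n) V, ⇑G = gHeat t F := by
  refine ⟨⟨gHeat t F, contDiff_infty.2 fun k => (gHeat_contDiff_decay ht k F).1,
    fun k m => ?_⟩, rfl⟩
  obtain ⟨C, h⟩ := (gHeat_contDiff_decay ht m F).2 k
  refine ⟨C, fun x => ?_⟩
  have h1 := h x
  rw [wt, ← div_eq_mul_inv, le_div_iff₀ (by positivity)] at h1
  refine le_trans ?_ h1
  rw [mul_comm]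
  gcongr
  linarith

end Schwartz

variable {n : ℕ}

/-- First derivative of a real Schwartz function, as a Schwartz function. -/
abbrev D1 (F : SchwartzMap (Eucl n) ℝ) : SchwartzMap (Eucl n) (Eucl n →L[ℝ] ℝ) :=
  SchwartzMap.fderivCLM ℝ (Eucl n) ℝ F

/-- Second derivative of a real Schwartz function, as a Schwartz function. -/
abbrev D2 (F : SchwartzMap (Eucl n) ℝ) : SchwartzMap (Eucl n) (Eucl n →L[ℝ] Eucl n →L[ℝ] ℝ) :=
  SchwartzMap.fderivCLM ℝ (Eucl n) (Eucl n →L[ℝ] ℝ) (D1 F)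

/-- The heat generator `Δ/2`, written as a Gaussian average of second derivatives. -/
def gen (F : SchwartzMap (Eucl n) ℝ) (x : Eucl n) : ℝ := (1 / 2) * ∫ z, D2 F x z z ∂stdG n

lemma hasFDerivAt_schwartz {V : Type} [NormedAddCommGroup V] [NormedSpace ℝ V]
    (F : SchwartzMap (Eucl n) V) (x : Eucl n) :
    HasFDerivAt F (SchwartzMap.fderivCLM ℝ (Eucl n) V F x) x :=
  (F.differentiableAt (x := x)).hasFDerivAt

lemma hasDerivAt_schwartz_line {V : Type} [NormedAddCommGroup V] [NormedSpace ℝ V]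
    (F : SchwartzMap (Eucl n) V) (x h : Eucl n) (s : ℝ) :
    HasDerivAt (fun s : ℝ => F (x + s • h)) (SchwartzMap.fderivCLM ℝ (Eucl n) V F (x + s • h) h)
      s := by
  have h1 : HasDerivAt (fun s : ℝ => x + s • h) h s := by
    simpa using ((hasDerivAt_id s).smul_const h).const_add x
  exact (hasFDerivAt_schwartz F (x + s • h)).comp_hasDerivAt s h1

lemma norm_sub_le_of_schwartz {V : Type} [NormedAddCommGroup V] [NormedSpace ℝ V]
    (F : SchwartzMap (Eucl n) V) (N : ℕ) :
    ∃ C, 0 ≤ C ∧ ∀ x h k : Eucl n, ∀ r, ‖h‖ ≤ r → ‖k‖ ≤ r →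
      ‖F (x + h) - F (x + k)‖ ≤ C * wt N x * (1 + r) ^ N * ‖h - k‖ := by
  obtain ⟨C, hC, hF⟩ := schwartz_decay (SchwartzMap.fderivCLM ℝ (Eucl n) V F) N
  refine ⟨C, hC, fun x h k r hr kr => ?_⟩
  have := (convex_closedBall (0 : Eucl n) r).norm_image_sub_le_of_norm_hasFDerivWithin_le
    (f := fun y => F (x + y)) (f' := fun y => SchwartzMap.fderivCLM ℝ (Eucl n) V F (x + y))
    (C := C * wt N x * (1 + r) ^ N) (x := k) (y := h)
    (fun y _ =>
      ((hasFDerivAt_comp_add_left x).2 (hasFDerivAt_schwartz F (x + y))).hasFDerivWithinAt)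
    (fun y hy => ?_) (by simpa using kr) (by simpa using hr)
  · exact this
  · have hy' : ‖y‖ ≤ r := by simpa using hy
    have := (wt_pos N x).le
    calc _ ≤ C * wt N (x + y) := hF _
      _ ≤ C * ((1 + ‖y‖) ^ N * wt N x) := by gcongr; exact wt_add_le N x y
      _ ≤ C * ((1 + r) ^ N * wt N x) := by gcongr
      _ = _ := by ring

lemma taylor_bound (F : SchwartzMap (Eucl n) ℝ) (N : ℕ) :
    ∃ C, 0 ≤ C ∧ ∀ x h : Eucl n,
      |F (x + h) - F x - D1 F x h| ≤ C * wt N x * (1 + ‖h‖) ^ N * ‖h‖ ^ 2 := by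
  obtain ⟨C, hC, hF⟩ := norm_sub_le_of_schwartz (D1 F) N
  refine ⟨C, hC, fun x h => ?_⟩
  have hw := (wt_pos N x).le
  have := (convex_closedBall (0 : Eucl n) ‖h‖).norm_image_sub_le_of_norm_hasFDerivWithin_le
    (f := fun y => F (x + y) - D1 F x y) (f' := fun y => D1 F (x + y) - D1 F x)
    (C := C * wt N x * (1 + ‖h‖) ^ N * ‖h‖) (x := 0) (y := h)
    (fun y _ => (((hasFDerivAt_comp_add_left x).2 (hasFDerivAt_schwartz F (x + y))).sub
      (D1 F x).hasFDerivAt).hasFDerivWithinAt)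
    (fun y hy => ?_) (by simp) (by simp)
  · simp only [add_zero, map_zero, sub_zero, Real.norm_eq_abs] at this
    rw [show F (x + h) - F x - D1 F x h = F (x + h) - D1 F x h - F x by ring]
    refine this.trans_eq (by ring)
  · have hy' : ‖y‖ ≤ ‖h‖ := by simpa using hy
    have := hF x y 0 ‖h‖ hy' (by simp)
    rw [add_zero, sub_zero] at this
    refine this.trans ?_
    gcongr

lemma gHeat_sub_eq (F : SchwartzMap (Eucl n) ℝ) (t : ℝ) (x : Eucl n) :
    gHeat t F x - F x = ∫ z, (F (x + √t • z) - F x - D1 F x (√t • z)) ∂stdG n := by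
  have hL : Integrable (fun z => D1 F x (√t • z)) (stdG n) := by
    simp only [map_smul]
    exact (IsGaussian.integrable_dual (stdG n) (D1 F x)).smul (√t)
  rw [integral_sub (f := fun z => F (x + √t • z) - F x)
    ((integrable_schwartz_comp_stdG F t x).sub (integrable_const (F x))) hL,
    integral_sub (integrable_schwartz_comp_stdG F t x) (integrable_const _)]
  simp only [map_smul, smul_eq_mul]
  rw [integral_const_mul, integral_clm_stdG]
  simp [gHeat]

lemma taylor_bound_sqrt (F : SchwartzMap (Eucl n) ℝ) (N : ℕ) :
    ∃ C, 0 ≤ C ∧ ∀ t ∈ Icc (0 : ℝ) 1, ∀ x z : Eucl n,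
      |F (x + √t • z) - F x - D1 F x (√t • z)| ≤ t * (C * wt N x * (1 + ‖z‖) ^ (N + 2)) := by
  obtain ⟨C, hC, hF⟩ := taylor_bound F N
  refine ⟨C, hC, fun t ht x z => (hF x _).trans ?_⟩
  have hw := (wt_pos N x).le
  have h1 : ‖√t • z‖ ^ 2 = t * ‖z‖ ^ 2 := by
    rw [norm_smul, mul_pow, Real.norm_of_nonneg (Real.sqrt_nonneg _), Real.sq_sqrt ht.1]
  have h2 := norm_sqrt_smul_le ht.2 z
  have ht0 := ht.1
  rw [h1, pow_add]
  calc C * wt N x * (1 + ‖√t • z‖) ^ N * (t * ‖z‖ ^ 2)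
      ≤ C * wt N x * (1 + ‖z‖) ^ N * (t * (1 + ‖z‖) ^ 2) := by
        gcongr
        linarith
    _ = _ := by ring

lemma gHeat_sub_bound (F : SchwartzMap (Eucl n) ℝ) (N : ℕ) :
    ∃ C, 0 ≤ C ∧ ∀ t ∈ Icc (0 : ℝ) 1, ∀ x, |gHeat t F x - F x| ≤ t * (C * wt N x) := by
  obtain ⟨C, hC, hF⟩ := taylor_bound_sqrt F N
  refine ⟨C * ∫ z, (1 + ‖z‖) ^ (N + 2) ∂stdG n, by positivity, fun t ht x => ?_⟩
  rw [gHeat_sub_eq, ← Real.norm_eq_abs]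
  refine (norm_integral_le_of_norm_le
    ((integrable_one_add_norm_pow_stdG n (N + 2)).const_mul (t * (C * wt N x)))
    (ae_of_all _ fun z => ?_)).trans_eq ?_
  · rw [Real.norm_eq_abs, mul_assoc]
    exact hF t ht x z
  · rw [integral_const_mul]; ring

lemma tendsto_second_order (F : SchwartzMap (Eucl n) ℝ) (x z : Eucl n) :
    Tendsto (fun t : ℝ => (F (x + √t • z) - F x - D1 F x (√t • z)) / t) (𝓝[>] 0)
      (𝓝 ((1 / 2) * D2 F x z z)) := by
  have key : Tendsto (fun s : ℝ => (F (x + s • z) - F x - D1 F x (s • z)) / s ^ 2) (𝓝[>] 0)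
      (𝓝 ((1 / 2) * D2 F x z z)) := by
    refine HasDerivAt.lhopital_zero_nhdsGT
      (f' := fun s => D1 F (x + s • z) z - D1 F x z) (g' := fun s => 2 * s)
      (Eventually.of_forall fun s => ?_) (Eventually.of_forall fun s => ?_) ?_ ?_ ?_ ?_
    · have h2 : HasDerivAt (fun s : ℝ => D1 F x (s • z)) (D1 F x z) s := by
        simp only [map_smul]
        simpa using (hasDerivAt_id s).smul_const (D1 F x z)
      exact ((hasDerivAt_schwartz_line F x z s).sub_const _).sub h2
    · simpa using hasDerivAt_pow 2 s
    · filter_upwards [self_mem_nhdsWithin] with s hs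
      exact mul_ne_zero two_ne_zero (ne_of_gt hs)
    · have hc : Continuous fun s : ℝ => F (x + s • z) - F x - D1 F x (s • z) := by
        have := F.continuous
        fun_prop
      simpa using (hc.tendsto 0).mono_left nhdsWithin_le_nhds
    · have hc : Continuous fun s : ℝ => s ^ 2 := by fun_prop
      simpa using (hc.tendsto 0).mono_left nhdsWithin_le_nhds
    · have h1 : HasDerivAt (fun s : ℝ => D1 F (x + s • z) z) (D2 F x z z) 0 := by
        have := hasDerivAt_schwartz_line (D1 F) x z 0
        rw [zero_smul, add_zero] at this
        exact this.clm_apply (hasDerivAt_const 0 z) |>.congr_deriv (by simp)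
      have h2 := (h1.tendsto_slope_zero_right).const_mul (1 / 2 : ℝ)
      refine h2.congr fun s => ?_
      simp only [zero_add, zero_smul, add_zero, smul_eq_mul]
      rw [mul_comm (2 : ℝ) s, ← div_div, div_eq_mul_inv _ s]
      ring
  have hs : Tendsto (fun t : ℝ => √t) (𝓝[>] 0) (𝓝[>] 0) := by
    refine tendsto_nhdsWithin_iff.2 ⟨?_, ?_⟩
    · simpa using (Real.continuous_sqrt.tendsto 0).mono_left nhdsWithin_le_nhds
    · filter_upwards [self_mem_nhdsWithin] with t ht using Real.sqrt_pos.2 ht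
  refine (key.comp hs).congr' ?_
  filter_upwards [self_mem_nhdsWithin] with t ht
  simp only [Function.comp]
  rw [Real.sq_sqrt (le_of_lt ht)]

lemma Ioc_zero_one_mem : Ioc (0 : ℝ) 1 ∈ 𝓝[>] (0 : ℝ) := Ioc_mem_nhdsGT one_pos

/-- `Δ/2` is the right derivative at `0` of the heat semigroup. -/
lemma tendsto_gHeat_sub_div (F : SchwartzMap (Eucl n) ℝ) (x : Eucl n) :
    Tendsto (fun t : ℝ => (gHeat t F x - F x) / t) (𝓝[>] 0) (𝓝 (gen F x)) := by
  obtain ⟨C, hC, hF⟩ := taylor_bound_sqrt F 0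
  rw [gen, ← integral_const_mul]
  have h : Tendsto (fun t : ℝ => ∫ z, (F (x + √t • z) - F x - D1 F x (√t • z)) / t ∂stdG n)
      (𝓝[>] 0) (𝓝 (∫ z, (1 / 2) * D2 F x z z ∂stdG n)) := by
    refine tendsto_integral_filter_of_dominated_convergence
      (fun z => C * wt 0 x * (1 + ‖z‖) ^ (0 + 2)) ?_ ?_
      ((integrable_one_add_norm_pow_stdG n (0 + 2)).const_mul _)
      (ae_of_all _ fun z => tendsto_second_order F x z)
    · refine Eventually.of_forall fun t => Continuous.aestronglyMeasurable ?_
      have := F.continuous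
      fun_prop
    · filter_upwards [Ioc_zero_one_mem] with t ht
      refine ae_of_all _ fun z => ?_
      rw [norm_div, Real.norm_eq_abs, Real.norm_of_nonneg ht.1.le, div_le_iff₀ ht.1, mul_comm]
      exact hF t ⟨ht.1.le, ht.2⟩ x z
  refine h.congr fun t => ?_
  rw [integral_div, gHeat_sub_eq]

/-- Backward-in-time difference bound for the heat flow at time `1`. -/
lemma gHeat_one_sub_bound (F : SchwartzMap (Eucl n) ℝ) (N : ℕ) :
    ∃ C, 0 ≤ C ∧ ∀ t ∈ Icc (0 : ℝ) 1, ∀ x,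
      |gHeat (1 - t) F x - gHeat 1 F x| ≤ t * (C * wt N x) := by
  obtain ⟨C, hC, hF⟩ := norm_sub_le_of_schwartz F N
  refine ⟨C * ∫ z, (1 + ‖z‖) ^ (N + 1) ∂stdG n, by positivity, fun t ht x => ?_⟩
  have hw := (wt_pos N x).le
  rw [gHeat, gHeat, ← integral_sub (integrable_schwartz_comp_stdG F _ x)
    (integrable_schwartz_comp_stdG F _ x), ← Real.norm_eq_abs]
  refine (norm_integral_le_of_norm_le
    ((integrable_one_add_norm_pow_stdG n (N + 1)).const_mul (t * (C * wt N x)))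
    (ae_of_all _ fun z => ?_)).trans_eq ?_
  · refine (hF x _ _ ‖z‖ (norm_sqrt_smul_le (by linarith [ht.1]) z)
      (norm_sqrt_smul_le le_rfl z)).trans ?_
    rw [← sub_smul, norm_smul, Real.sqrt_one, Real.norm_eq_abs, abs_sub_comm, abs_of_nonneg
      (sub_nonneg.2 (Real.sqrt_le_one.2 (by linarith [ht.1])))]
    have h1 : 1 - √(1 - t) ≤ t := by
      have : 1 - t ≤ √(1 - t) := by
        apply Real.le_sqrt_of_sq_le
        nlinarith [ht.1, ht.2]
      linarith
    have ht0 := ht.1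
    rw [pow_succ]
    calc C * wt N x * (1 + ‖z‖) ^ N * ((1 - √(1 - t)) * ‖z‖)
        ≤ C * wt N x * (1 + ‖z‖) ^ N * (t * (1 + ‖z‖)) := by
          gcongr
          linarith
      _ = _ := by ring
  · rw [integral_const_mul]; ring

lemma exists_hasDerivAt_gHeat_time (F : SchwartzMap (Eucl n) ℝ) (x : Eucl n) :
    ∃ d, HasDerivAt (fun s => gHeat s F x) d 1 := by
  obtain ⟨C, hC, hF⟩ := schwartz_decay (D1 F) 0
  refine ⟨_, (hasDerivAt_integral_of_dominated_loc_of_deriv_le (s := Ioi (1 / 4 : ℝ)) (x₀ := 1)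
    (F := fun s z => F (x + √s • z))
    (F' := fun s z => (D1 F (x + √s • z)) ((1 / (2 * √s)) • z))
    (bound := fun z => C * (1 + ‖z‖) ^ 1) (Ioi_mem_nhds (by norm_num))
    (Eventually.of_forall fun s => (integrable_schwartz_comp_stdG F s x).1)
    (integrable_schwartz_comp_stdG F 1 x) ?_ (ae_of_all _ fun z s hs => ?_)
    ((integrable_one_add_norm_pow_stdG n 1).const_mul C) (ae_of_all _ fun z s hs => ?_)).2⟩
  · have := (D1 F).continuous
    exact Continuous.aestronglyMeasurable (by fun_prop)
  · have h1 := hF (x + √s • z)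
    simp only [wt, pow_zero, inv_one, mul_one] at h1
    have hs' : (1 / 2 : ℝ) ≤ √s := Real.le_sqrt_of_sq_le (by
      have : (1 / 4 : ℝ) < s := hs
      nlinarith)
    refine ((D1 F (x + √s • z)).le_opNorm _).trans ?_
    rw [norm_smul, Real.norm_of_nonneg (by positivity), pow_one]
    have h2 : 1 / (2 * √s) ≤ 1 := by
      rw [div_le_one (by positivity)]; linarith
    calc _ ≤ C * (1 * ‖z‖) := by gcongr
      _ ≤ _ := by gcongr; linarith
  · have hs' : (0 : ℝ) < s := lt_trans (by norm_num) hs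
    have h1 : HasDerivAt (fun s : ℝ => x + √s • z) ((1 / (2 * √s)) • z) s := by
      simpa using ((Real.hasDerivAt_sqrt hs'.ne').smul_const z).const_add x
    exact (hasFDerivAt_schwartz F (x + √s • z)).comp_hasDerivAt s h1

/-- Left derivative at time `1` of the heat flow, computed with the semigroup law. -/
lemma tendsto_gHeat_one_sub_div (F F1 : SchwartzMap (Eucl n) ℝ) (hF1 : ⇑F1 = gHeat 1 F)
    (x : Eucl n) :
    Tendsto (fun t : ℝ => (gHeat (1 - t) F x - gHeat 1 F x) / t) (𝓝[>] 0)
      (𝓝 (-gen F1 x)) := by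
  obtain ⟨d, hd⟩ := exists_hasDerivAt_gHeat_time F x
  obtain ⟨C, hC, hF⟩ := schwartz_decay F 0
  have hCF : ∀ x, |F x| ≤ C := fun x => by simpa [wt] using hF x
  have hdg : d = gen F1 x := by
    refine tendsto_nhds_unique ?_ (tendsto_gHeat_sub_div F1 x)
    refine hd.tendsto_slope_zero_right.congr' ?_
    filter_upwards [self_mem_nhdsWithin] with t ht
    rw [hF1, gHeat_gHeat (le_of_lt ht) zero_le_one F.continuous hCF, add_comm t 1, smul_eq_mul,
      inv_mul_eq_div]
  rw [← hdg]
  have hd' : HasDerivAt (fun t : ℝ => gHeat (1 - t) F x) (-d) 0 := by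
    have h0 : HasDerivAt (fun t : ℝ => 1 - t) (-1) 0 := by
      simpa using (hasDerivAt_id (0 : ℝ)).const_sub 1
    have h1 : HasDerivAt (fun s => gHeat s F x) d ((fun t : ℝ => 1 - t) 0) := by simpa using hd
    have h2 := h1.comp (0 : ℝ) h0
    rw [mul_neg_one] at h2
    exact h2
  refine hd'.tendsto_slope_zero_right.congr fun t => ?_
  simp [inv_mul_eq_div]

/-- Continuous functions decaying faster than any polynomial. -/
def RapidDecay (h : Eucl n → ℝ) : Prop :=
  Continuous h ∧ ∀ N, ∃ C, 0 ≤ C ∧ ∀ x, |h x| ≤ C * wt N x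

/-- Continuous functions of at most quadratic growth. -/
def QuadGrowth (h : Eucl n → ℝ) : Prop :=
  Continuous h ∧ ∃ K, 0 ≤ K ∧ ∀ x, |h x| ≤ K * (1 + ‖x‖) ^ 2

lemma RapidDecay.integrable {h : Eucl n → ℝ} (hh : RapidDecay h) : Integrable h := by
  obtain ⟨C, hC, hb⟩ := hh.2 (n + 1)
  exact ((integrable_wt (n + 1) (Nat.lt_succ_self n)).const_mul C).mono'
    hh.1.aestronglyMeasurable (ae_of_all _ hb)

lemma RapidDecay.add {h k : Eucl n → ℝ} (hh : RapidDecay h) (hk : RapidDecay k) :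
    RapidDecay fun x => h x + k x := by
  refine ⟨hh.1.add hk.1, fun N => ?_⟩
  obtain ⟨C, hC, h1⟩ := hh.2 N
  obtain ⟨D, hD, h2⟩ := hk.2 N
  refine ⟨C + D, by positivity, fun x => (abs_add_le _ _).trans ?_⟩
  rw [add_mul]
  exact add_le_add (h1 x) (h2 x)

lemma RapidDecay.const_mul {h : Eucl n → ℝ} (hh : RapidDecay h) (a : ℝ) :
    RapidDecay fun x => a * h x := by
  refine ⟨continuous_const.mul hh.1, fun N => ?_⟩
  obtain ⟨C, hC, h1⟩ := hh.2 N
  refine ⟨|a| * C, by positivity, fun x => ?_⟩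
  rw [abs_mul, mul_assoc]
  exact mul_le_mul_of_nonneg_left (h1 x) (abs_nonneg a)

lemma RapidDecay.sub {h k : Eucl n → ℝ} (hh : RapidDecay h) (hk : RapidDecay k) :
    RapidDecay fun x => h x - k x := by
  have := hh.add (hk.const_mul (-1))
  simpa [sub_eq_add_neg] using this

lemma RapidDecay.mul_quadGrowth {h k : Eucl n → ℝ} (hh : RapidDecay h) (hk : QuadGrowth k) :
    RapidDecay fun x => h x * k x := by
  refine ⟨hh.1.mul hk.1, fun N => ?_⟩
  obtain ⟨C, hC, h1⟩ := hh.2 (N + 2)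
  obtain ⟨K, hK, h2⟩ := hk.2
  refine ⟨C * K, by positivity, fun x => ?_⟩
  rw [abs_mul]
  have := (wt_pos (N + 2) x).le
  calc |h x| * |k x| ≤ (C * wt (N + 2) x) * (K * (1 + ‖x‖) ^ 2) :=
        mul_le_mul (h1 x) (h2 x) (abs_nonneg _) (by positivity)
    _ = C * K * (wt (N + 2) x * (1 + ‖x‖) ^ 2) := by ring
    _ = _ := by rw [wt_mul_pow]

lemma RapidDecay.quadGrowth {h : Eucl n → ℝ} (hh : RapidDecay h) : QuadGrowth h := by
  obtain ⟨C, hC, h1⟩ := hh.2 0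
  refine ⟨hh.1, C, hC, fun x => (h1 x).trans ?_⟩
  gcongr
  exact (wt_le_one 0 x).trans (one_le_pow₀ (by linarith [norm_nonneg x]))

lemma RapidDecay.mul {h k : Eucl n → ℝ} (hh : RapidDecay h) (hk : RapidDecay k) :
    RapidDecay fun x => h x * k x := hh.mul_quadGrowth hk.quadGrowth

lemma QuadGrowth.add {h k : Eucl n → ℝ} (hh : QuadGrowth h) (hk : QuadGrowth k) :
    QuadGrowth fun x => h x + k x := by
  obtain ⟨C, hC, h1⟩ := hh.2
  obtain ⟨D, hD, h2⟩ := hk.2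
  refine ⟨hh.1.add hk.1, C + D, by positivity, fun x => (abs_add_le _ _).trans ?_⟩
  rw [add_mul]
  exact add_le_add (h1 x) (h2 x)

lemma quadGrowth_const (a : ℝ) : QuadGrowth fun _ : Eucl n => a :=
  ⟨continuous_const, |a|, abs_nonneg a, fun x =>
    le_mul_of_one_le_right (abs_nonneg a) (one_le_pow₀ (by linarith [norm_nonneg x]))⟩

lemma rapidDecay_schwartz (F : SchwartzMap (Eucl n) ℝ) : RapidDecay F :=
  ⟨F.continuous, fun N => schwartz_decay F N⟩

lemma rapidDecay_D1 (F : SchwartzMap (Eucl n) ℝ) (z : Eucl n) :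
    RapidDecay fun x => D1 F x z := by
  refine ⟨(D1 F).continuous.clm_apply continuous_const, fun N => ?_⟩
  obtain ⟨C, hC, h⟩ := schwartz_decay (D1 F) N
  refine ⟨C * ‖z‖, by positivity, fun x => ((D1 F x).le_opNorm z).trans ?_⟩
  calc _ ≤ C * wt N x * ‖z‖ := by gcongr; exact h x
    _ = _ := by ring

lemma rapidDecay_gaussian_average {q : Eucl n → Eucl n → ℝ} (hq : Continuous fun p :
    Eucl n × Eucl n => q p.1 p.2)
    (hb : ∀ N, ∃ C, 0 ≤ C ∧ ∀ x z, |q x z| ≤ C * wt N x * (1 + ‖z‖) ^ 2) :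
    RapidDecay fun x => ∫ z, q x z ∂stdG n := by
  constructor
  · obtain ⟨C, hC, h⟩ := hb 0
    refine continuous_of_dominated (bound := fun z => C * (1 + ‖z‖) ^ 2)
      (fun x => (hq.comp (by fun_prop : Continuous fun z : Eucl n =>
        (x, z))).aestronglyMeasurable)
      (fun x => ae_of_all _ fun z => ?_) ((integrable_one_add_norm_pow_stdG n 2).const_mul C)
      (ae_of_all _ fun z => hq.comp (by fun_prop : Continuous fun x : Eucl n => (x, z)))
    simpa [wt] using h x z
  · intro N
    obtain ⟨C, hC, h⟩ := hb N
    refine ⟨C * ∫ z, (1 + ‖z‖) ^ 2 ∂stdG n, by positivity, fun x => ?_⟩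
    rw [← Real.norm_eq_abs]
    refine (norm_integral_le_of_norm_le
      ((integrable_one_add_norm_pow_stdG n 2).const_mul (C * wt N x))
      (ae_of_all _ fun z => h x z)).trans_eq ?_
    rw [integral_const_mul]; ring

lemma D2_bound (F : SchwartzMap (Eucl n) ℝ) (N : ℕ) :
    ∃ C, 0 ≤ C ∧ ∀ x z, |D2 F x z z| ≤ C * wt N x * (1 + ‖z‖) ^ 2 := by
  obtain ⟨C, hC, h⟩ := schwartz_decay (D2 F) N
  refine ⟨C, hC, fun x z => ((D2 F x).le_opNorm₂ z z).trans ?_⟩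
  have := (wt_pos N x).le
  rw [mul_assoc, ← sq]
  gcongr
  · exact h x
  · linarith

lemma continuous_D2 (F : SchwartzMap (Eucl n) ℝ) :
    Continuous fun p : Eucl n × Eucl n => D2 F p.1 p.2 p.2 := by
  have := (D2 F).continuous
  fun_prop

lemma rapidDecay_gen (F : SchwartzMap (Eucl n) ℝ) : RapidDecay (gen F) :=
  (rapidDecay_gaussian_average (continuous_D2 F) (D2_bound F)).const_mul (1 / 2)

/-- The carré du champ of two Schwartz functions, as a Gaussian average. -/
def carre (F G : SchwartzMap (Eucl n) ℝ) (x : Eucl n) : ℝ := ∫ z, D1 F x z * D1 G x z ∂stdG n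

lemma D1_mul_bound (F G : SchwartzMap (Eucl n) ℝ) (N : ℕ) :
    ∃ C, 0 ≤ C ∧ ∀ x z, |D1 F x z * D1 G x z| ≤ C * wt N x * (1 + ‖z‖) ^ 2 := by
  obtain ⟨C, hC, h⟩ := schwartz_decay (D1 F) N
  obtain ⟨D, hD, h'⟩ := schwartz_decay (D1 G) 0
  refine ⟨C * D, by positivity, fun x z => ?_⟩
  have hw := (wt_pos N x).le
  have hx := h' x
  simp only [wt, pow_zero, inv_one, mul_one] at hx
  rw [abs_mul]
  calc |D1 F x z| * |D1 G x z| ≤ (‖D1 F x‖ * ‖z‖) * (‖D1 G x‖ * ‖z‖) :=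
        mul_le_mul ((D1 F x).le_opNorm z) ((D1 G x).le_opNorm z) (abs_nonneg _) (by positivity)
    _ ≤ (C * wt N x * (1 + ‖z‖)) * (D * (1 + ‖z‖)) := by
        gcongr
        · exact h x
        · linarith
        · linarith
    _ = _ := by ring

lemma continuous_D1_mul (F G : SchwartzMap (Eucl n) ℝ) :
    Continuous fun p : Eucl n × Eucl n => D1 F p.1 p.2 * D1 G p.1 p.2 := by
  have := (D1 F).continuous
  have := (D1 G).continuous
  fun_prop

lemma integrable_stdG_of_bound {q : Eucl n → ℝ} (hq : Continuous q) {C : ℝ}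
    (hb : ∀ z, |q z| ≤ C * (1 + ‖z‖) ^ 2) : Integrable q (stdG n) :=
  ((integrable_one_add_norm_pow_stdG n 2).const_mul C).mono' hq.aestronglyMeasurable
    (ae_of_all _ hb)

lemma integrable_D2 (F : SchwartzMap (Eucl n) ℝ) (x : Eucl n) :
    Integrable (fun z => D2 F x z z) (stdG n) := by
  obtain ⟨C, hC, h⟩ := D2_bound F 0
  exact integrable_stdG_of_bound
    ((continuous_D2 F).comp (by fun_prop : Continuous fun z : Eucl n => (x, z))) (h x)

lemma integrable_D1_mul (F G : SchwartzMap (Eucl n) ℝ) (x : Eucl n) :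
    Integrable (fun z => D1 F x z * D1 G x z) (stdG n) := by
  obtain ⟨C, hC, h⟩ := D1_mul_bound F G 0
  exact integrable_stdG_of_bound
    ((continuous_D1_mul F G).comp (by fun_prop : Continuous fun z : Eucl n => (x, z))) (h x)

/-- Leibniz rule for the heat generator. -/
lemma gen_mul (F G H : SchwartzMap (Eucl n) ℝ) (hH : ∀ x, H x = F x * G x) (x : Eucl n) :
    gen H x = G x * gen F x + F x * gen G x + carre F G x := by
  have hH' : ⇑H = fun x => F x * G x := funext hH
  have h1 : ∀ x, D1 H x = F x • D1 G x + G x • D1 F x := fun x => by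
    have h := (hasFDerivAt_schwartz F x).mul (hasFDerivAt_schwartz G x)
    exact HasFDerivAt.unique (hasFDerivAt_schwartz H x) (by rw [hH']; exact h)
  have h1' : ⇑(D1 H) = fun x => F x • D1 G x + G x • D1 F x := funext h1
  have h2 : ∀ z, D2 H x z z = G x * D2 F x z z + F x * D2 G x z z
      + 2 * (D1 F x z * D1 G x z) := fun z => by
    have h := ((hasFDerivAt_schwartz F x).smul (hasFDerivAt_schwartz (D1 G) x)).add
      ((hasFDerivAt_schwartz G x).smul (hasFDerivAt_schwartz (D1 F) x))
    have h3 := HasFDerivAt.unique (hasFDerivAt_schwartz (D1 H) x) (by rw [h1']; exact h)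
    change SchwartzMap.fderivCLM ℝ _ _ (D1 H) x z z = _
    rw [h3]
    simp only [add_apply, smul_apply,
      ContinuousLinearMap.smulRight_apply, smul_eq_mul]
    ring
  simp only [gen, carre, h2]
  have i1 := (integrable_D2 F x).const_mul (G x)
  have i2 := (integrable_D2 G x).const_mul (F x)
  have i3 := (integrable_D1_mul F G x).const_mul 2
  rw [integral_add (f := fun z => G x * D2 F x z z + F x * D2 G x z z) (i1.add i2) i3,
    integral_add i1 i2, integral_const_mul, integral_const_mul, integral_const_mul]
  ring

lemma integral_fderiv_apply_eq_zero {h : Eucl n → ℝ} {h' : Eucl n → Eucl n →L[ℝ] ℝ}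
    {z : Eucl n} (hd : ∀ x, HasFDerivAt h (h' x) x) (hi : Integrable h)
    (hi' : Integrable fun x => h' x z) : ∫ x, h' x z = 0 := by
  have := integral_bilinear_hasFDerivAt_right_eq_neg_left_of_integrable (μ := volume)
    (f := fun _ : Eucl n => (1 : ℝ)) (f' := fun _ => 0) (g := h) (g' := h') (v := z)
    (B := ContinuousLinearMap.mul ℝ ℝ) (by simp) (by simpa using hi') (by simpa using hi)
    (fun x _ => hasFDerivAt_const 1 x) (fun x _ => hd x)
  simpa using this

/-- The divergence identity behind the derivative formula. -/
lemma integral_divergence (g F : SchwartzMap (Eucl n) ℝ) (hg : ∀ x, 0 < g x) (hF : ∀ x, 0 < F x)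
    (hlg : QuadGrowth fun x => Real.log (g x)) (hlF : QuadGrowth fun x => Real.log (F x)) :
    ∫ x, ((Real.log (g x) - Real.log (F x) - 1) * carre g F x / 2
      + g x * Real.log (g x) * gen F x - F x * Real.log (F x) * gen g x - F x * gen g x) = 0 := by
  have hlF' : QuadGrowth fun x => -(Real.log (F x)) - 1 := by
    obtain ⟨K, hK, h⟩ := hlF.2
    have : QuadGrowth fun x => -(Real.log (F x)) := ⟨hlF.1.neg, K, hK, by simpa using h⟩
    simpa [sub_eq_add_neg] using this.add (quadGrowth_const (-1))
  have hsum : QuadGrowth fun x => Real.log (g x) + (-(Real.log (F x)) - 1) := hlg.add hlF'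
  have gRD := rapidDecay_schwartz g
  have FRD := rapidDecay_schwartz F
  set J : Eucl n → Eucl n → ℝ := fun x z =>
    (Real.log (g x) + (-(Real.log (F x)) - 1)) * (D1 g x z * D1 F x z)
      + g x * Real.log (g x) * D2 F x z z - F x * Real.log (F x) * D2 g x z z
      - F x * D2 g x z z with hJ
  have hJc : Continuous fun p : Eucl n × Eucl n => J p.1 p.2 := by
    have c1 := continuous_D1_mul g F
    have c2 := continuous_D2 g
    have c3 := continuous_D2 F
    have c4 := hlg.1.comp (continuous_fst : Continuous fun p : Eucl n × Eucl n => p.1)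
    have c5 := hlF.1.comp (continuous_fst : Continuous fun p : Eucl n × Eucl n => p.1)
    have c6 := g.continuous.comp (continuous_fst : Continuous fun p : Eucl n × Eucl n => p.1)
    have c7 := F.continuous.comp (continuous_fst : Continuous fun p : Eucl n × Eucl n => p.1)
    exact ((((c4.add (c5.neg.sub continuous_const)).mul c1).add ((c6.mul c4).mul c3)).sub
      ((c7.mul c5).mul c2)).sub (c7.mul c2)
  have hJb : ∃ C, 0 ≤ C ∧ ∀ x z, |J x z| ≤ C * wt (n + 1) x * (1 + ‖z‖) ^ 2 := by
    obtain ⟨C1, hC1, b1⟩ := D1_mul_bound g F (n + 1 + 2)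
    obtain ⟨C2, hC2, b2⟩ := D2_bound F 0
    obtain ⟨C3, hC3, b3⟩ := D2_bound g 0
    obtain ⟨K, hK, bK⟩ := hsum.2
    obtain ⟨A, hA, bA⟩ := (gRD.mul_quadGrowth hlg).2 (n + 1)
    obtain ⟨B, hB, bB⟩ := (FRD.mul_quadGrowth hlF).2 (n + 1)
    obtain ⟨D, hD, bD⟩ := FRD.2 (n + 1)
    simp only [wt, pow_zero, inv_one, mul_one] at b2 b3
    refine ⟨K * C1 + A * C2 + B * C3 + D * C3, by positivity, fun x z => ?_⟩
    have hw := (wt_pos (n + 1) x).le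
    have hw2 := (wt_pos (n + 1 + 2) x).le
    have e1 : |(Real.log (g x) + (-(Real.log (F x)) - 1)) * (D1 g x z * D1 F x z)|
        ≤ K * C1 * wt (n + 1) x * (1 + ‖z‖) ^ 2 := by
      rw [abs_mul, ← wt_mul_pow (n + 1) 2 x]
      calc _ ≤ (K * (1 + ‖x‖) ^ 2) * (C1 * wt (n + 1 + 2) x * (1 + ‖z‖) ^ 2) :=
            mul_le_mul (bK x) (b1 x z) (abs_nonneg _) (by positivity)
        _ = _ := by ring
    have e2 : |g x * Real.log (g x) * D2 F x z z| ≤ A * C2 * wt (n + 1) x * (1 + ‖z‖) ^ 2 := by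
      rw [abs_mul]
      calc _ ≤ (A * wt (n + 1) x) * (C2 * (1 + ‖z‖) ^ 2) :=
            mul_le_mul (bA x) (b2 x z) (abs_nonneg _) (by positivity)
        _ = _ := by ring
    have e3 : |F x * Real.log (F x) * D2 g x z z| ≤ B * C3 * wt (n + 1) x * (1 + ‖z‖) ^ 2 := by
      rw [abs_mul]
      calc _ ≤ (B * wt (n + 1) x) * (C3 * (1 + ‖z‖) ^ 2) :=
            mul_le_mul (bB x) (b3 x z) (abs_nonneg _) (by positivity)
        _ = _ := by ring
    have e4 : |F x * D2 g x z z| ≤ D * C3 * wt (n + 1) x * (1 + ‖z‖) ^ 2 := by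
      rw [abs_mul]
      calc _ ≤ (D * wt (n + 1) x) * (C3 * (1 + ‖z‖) ^ 2) :=
            mul_le_mul (bD x) (b3 x z) (abs_nonneg _) (by positivity)
        _ = _ := by ring
    rw [abs_le] at e1 e2 e3 e4 ⊢
    simp only [hJ, add_mul]
    constructor <;> linarith [e1.1, e1.2, e2.1, e2.2, e3.1, e3.2, e4.1, e4.2]
  obtain ⟨C, hC, hb⟩ := hJb
  have hJi : Integrable (fun p : Eucl n × Eucl n => J p.1 p.2) (volume.prod (stdG n)) := by
    refine (((integrable_wt (n := n) (n + 1) (Nat.lt_succ_self n)).const_mul C).mul_prod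
      (integrable_one_add_norm_pow_stdG n 2)).mono' hJc.aestronglyMeasurable
      (ae_of_all _ fun p => hb p.1 p.2)
  have hz : ∀ z, ∫ x, J x z = 0 := fun z => by
    have hJz : Integrable fun x => J x z := by
      refine (((integrable_wt (n := n) (n + 1) (Nat.lt_succ_self n)).const_mul C).mul_const
        ((1 + ‖z‖) ^ 2)).mono' (hJc.comp
          (by fun_prop : Continuous fun x : Eucl n => (x, z))).aestronglyMeasurable
        (ae_of_all _ fun x => hb x z)
    have dg := fun x => hasFDerivAt_schwartz g x
    have dF := fun x => hasFDerivAt_schwartz F x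
    have d2g : ∀ x, HasFDerivAt (fun x => D1 g x z) ((D2 g x).flip z) x := fun x => by
      have := (hasFDerivAt_schwartz (D1 g) x).clm_apply (hasFDerivAt_const z x)
      refine this.congr_fderiv ?_
      ext y; simp
    have d2F : ∀ x, HasFDerivAt (fun x => D1 F x z) ((D2 F x).flip z) x := fun x => by
      have := (hasFDerivAt_schwartz (D1 F) x).clm_apply (hasFDerivAt_const z x)
      refine this.congr_fderiv ?_
      ext y; simp
    have hd := fun x => ((((dg x).mul ((dg x).log (hg x).ne')).mul (d2F x)).sub
      (((dF x).mul ((dF x).log (hF x).ne')).mul (d2g x))).sub ((dF x).mul (d2g x))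
    have hval : ∀ x, J x z = ((g x * Real.log (g x)) • ((D2 F x).flip z) + (D1 F x z) •
        (g x • ((g x)⁻¹ • D1 g x) + Real.log (g x) • D1 g x)
        - ((F x * Real.log (F x)) • ((D2 g x).flip z) + (D1 g x z) •
        (F x • ((F x)⁻¹ • D1 F x) + Real.log (F x) • D1 F x))
        - (F x • ((D2 g x).flip z) + D1 g x z • D1 F x)) z := fun x => by
      have := (hg x).ne'
      have := (hF x).ne'
      simp only [hJ, add_apply, sub_apply, smul_apply, smul_eq_mul,
        ContinuousLinearMap.flip_apply]
      field_simp
      ring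
    simp_rw [hval] at hJz ⊢
    refine integral_fderiv_apply_eq_zero hd ?_ hJz
    exact (((gRD.mul_quadGrowth hlg).mul (rapidDecay_D1 F z)).sub
      ((FRD.mul_quadGrowth hlF).mul (rapidDecay_D1 g z))).sub
      (FRD.mul (rapidDecay_D1 g z)) |>.integrable
  have hx : ∀ x, ∫ z, J x z ∂stdG n = 2 * ((Real.log (g x) - Real.log (F x) - 1) * carre g F x / 2
      + g x * Real.log (g x) * gen F x - F x * Real.log (F x) * gen g x - F x * gen g x) := by
    intro x
    have i1 := (integrable_D1_mul g F x).const_mul (Real.log (g x) + (-(Real.log (F x)) - 1))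
    have i2 := (integrable_D2 F x).const_mul (g x * Real.log (g x))
    have i3 := (integrable_D2 g x).const_mul (F x * Real.log (F x))
    have i4 := (integrable_D2 g x).const_mul (F x)
    simp only [hJ]
    rw [integral_sub (f := fun z => (Real.log (g x) + (-(Real.log (F x)) - 1)) *
          (D1 g x z * D1 F x z) + g x * Real.log (g x) * D2 F x z z
          - F x * Real.log (F x) * D2 g x z z) ((i1.add i2).sub i3) i4,
      integral_sub (f := fun z => (Real.log (g x) + (-(Real.log (F x)) - 1)) *
          (D1 g x z * D1 F x z) + g x * Real.log (g x) * D2 F x z z) (i1.add i2) i3,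
      integral_add i1 i2]
    rw [integral_const_mul, integral_const_mul, integral_const_mul, integral_const_mul]
    simp only [gen, carre]
    ring
  have hfub := integral_integral_swap (f := J) hJi
  simp_rw [hz, hx] at hfub
  rw [integral_zero, integral_const_mul] at hfub
  linarith

/-- The two forms of the derivative agree, by integration by parts. -/
lemma gen_identity (g F v : SchwartzMap (Eucl n) ℝ) (hg : ∀ x, 0 < g x) (hF : ∀ x, 0 < F x)
    (hv : ∀ x, v x = g x * F x)
    (hlg : QuadGrowth fun x => Real.log (g x)) (hlF : QuadGrowth fun x => Real.log (F x)) :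
    (∫ x, gen v x * Real.log (g x)) - (1 / 2) * ∫ x, (1 + Real.log (v x)) * gen v x
      = (1 / 2) * ∫ x, (1 + Real.log (v x)) * (F x * gen g x - g x * gen F x) := by
  have hlog : ∀ x, Real.log (v x) = Real.log (g x) + Real.log (F x) := fun x => by
    rw [hv, Real.log_mul (hg x).ne' (hF x).ne']
  have hlv : QuadGrowth fun x => 1 + Real.log (v x) := by
    simp_rw [hlog]
    exact (quadGrowth_const 1).add (hlg.add hlF)
  have gRD := rapidDecay_schwartz g
  have FRD := rapidDecay_schwartz F
  have i1 : Integrable fun x => gen v x * Real.log (g x) :=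
    ((rapidDecay_gen v).mul_quadGrowth hlg).integrable
  have i2 : Integrable fun x => (1 + Real.log (v x)) * gen v x := by
    simp_rw [mul_comm (1 + Real.log _)]
    exact ((rapidDecay_gen v).mul_quadGrowth hlv).integrable
  have i3 : Integrable fun x => (1 + Real.log (v x)) * (F x * gen g x - g x * gen F x) := by
    simp_rw [mul_comm (1 + Real.log _)]
    exact (((FRD.mul (rapidDecay_gen g)).sub (gRD.mul (rapidDecay_gen F))).mul_quadGrowth
      hlv).integrable
  rw [← sub_eq_zero, ← integral_const_mul, ← integral_const_mul,
    ← integral_sub i1 (i2.const_mul _),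
    ← integral_sub (f := fun x => gen v x * Real.log (g x)
      - 1 / 2 * ((1 + Real.log (v x)) * gen v x)) (i1.sub (i2.const_mul _)) (i3.const_mul _),
    ← integral_divergence g F hg hF hlg hlF]
  congr 1
  ext x
  rw [gen_mul g F v hv, hlog]
  ring

/-- Functions bounded below by a Gaussian. -/
def GaussLower (h : Eucl n → ℝ) : Prop :=
  ∃ α c : ℝ, 0 < α ∧ 0 < c ∧ ∀ x, c * Real.exp (-α * ‖x‖ ^ 2) ≤ h x

lemma GaussLower.pos {h : Eucl n → ℝ} (hh : GaussLower h) (x : Eucl n) : 0 < h x := by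
  obtain ⟨α, c, -, hc, hb⟩ := hh
  exact lt_of_lt_of_le (by positivity) (hb x)

lemma GaussLower.mul {h k : Eucl n → ℝ} (hh : GaussLower h) (hk : GaussLower k) :
    GaussLower fun x => h x * k x := by
  have hp := hh.pos
  obtain ⟨α, c, hα, hc, hb⟩ := hh
  obtain ⟨β, d, hβ, hd, hb'⟩ := hk
  refine ⟨α + β, c * d, by positivity, by positivity, fun x => ?_⟩
  calc c * d * Real.exp (-(α + β) * ‖x‖ ^ 2)
      = (c * Real.exp (-α * ‖x‖ ^ 2)) * (d * Real.exp (-β * ‖x‖ ^ 2)) := by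
        rw [neg_add, add_mul, Real.exp_add]; ring
    _ ≤ _ := mul_le_mul (hb x) (hb' x) (by positivity) (hp x).le

lemma gHeat_gaussLower (F : SchwartzMap (Eucl n) ℝ) (hF : GaussLower F) :
    ∃ α c : ℝ, 0 < α ∧ 0 < c ∧ ∀ t ≤ (1 : ℝ), ∀ x,
      c * Real.exp (-α * ‖x‖ ^ 2) ≤ gHeat t F x := by
  obtain ⟨α, c, hα, hc, hb⟩ := hF
  have hint : Integrable (fun z : Eucl n => Real.exp (-(2 * α) * ‖z‖ ^ 2)) (stdG n) :=
    (integrable_const (1 : ℝ)).mono' (by fun_prop) (ae_of_all _ fun z => by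
      rw [Real.norm_of_nonneg (Real.exp_pos _).le, Real.exp_le_one_iff]
      nlinarith [sq_nonneg ‖z‖])
  refine ⟨2 * α, c * ∫ z, Real.exp (-(2 * α) * ‖z‖ ^ 2) ∂stdG n, by positivity,
    mul_pos hc (integral_exp_pos hint), fun t ht x => ?_⟩
  rw [mul_right_comm, ← integral_const_mul]
  refine integral_mono (hint.const_mul _) (integrable_schwartz_comp_stdG F t x) fun z => ?_
  refine le_trans ?_ (hb _)
  rw [mul_assoc, ← Real.exp_add]
  gcongr
  have h1 : ‖x + √t • z‖ ≤ ‖x‖ + ‖z‖ :=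
    (norm_add_le _ _).trans (by gcongr; exact norm_sqrt_smul_le ht z)
  have h2 : ‖x + √t • z‖ ^ 2 ≤ 2 * ‖x‖ ^ 2 + 2 * ‖z‖ ^ 2 :=
    (pow_le_pow_left₀ (norm_nonneg _) h1 2).trans (by nlinarith [sq_nonneg (‖x‖ - ‖z‖)])
  nlinarith

lemma abs_log_le {y c α C r : ℝ} (hα : 0 < α) (hc : 0 < c) (hC : 0 ≤ C) (hr : 0 ≤ r)
    (h1 : c * Real.exp (-α * r ^ 2) ≤ y) (h2 : y ≤ C) :
    |Real.log y| ≤ (|Real.log c| + α + C) * (1 + r) ^ 2 := by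
  have hy : 0 < y := lt_of_lt_of_le (by positivity) h1
  have hlow : Real.log c - α * r ^ 2 ≤ Real.log y := by
    refine le_trans (le_of_eq ?_) (Real.log_le_log (by positivity) h1)
    rw [Real.log_mul hc.ne' (Real.exp_pos _).ne', Real.log_exp]; ring
  have hup := Real.log_le_sub_one_of_pos hy
  have h3 := neg_abs_le (Real.log c)
  have h0 := abs_nonneg (Real.log c)
  have e1 : (1 : ℝ) ≤ (1 + r) ^ 2 := one_le_pow₀ (by linarith)
  have e2 : r ^ 2 ≤ (1 + r) ^ 2 := pow_le_pow_left₀ hr (by linarith) 2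
  have a1 := mul_le_mul_of_nonneg_left e1 h0
  have a2 := mul_le_mul_of_nonneg_left e1 hC
  have a3 := mul_le_mul_of_nonneg_left e2 hα.le
  have a4 : 0 ≤ α * r ^ 2 := by positivity
  rw [abs_le, add_mul, add_mul]
  constructor <;> linarith

/-- Uniform quadratic bound for the logarithm of the heat flow. -/
lemma log_gHeat_bound (F : SchwartzMap (Eucl n) ℝ) (hF : GaussLower F) :
    ∃ K, 0 ≤ K ∧ ∀ t ≤ (1 : ℝ), ∀ x, |Real.log (gHeat t F x)| ≤ K * (1 + ‖x‖) ^ 2 := by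
  obtain ⟨α, c, hα, hc, hb⟩ := gHeat_gaussLower F hF
  obtain ⟨C, hC, hup⟩ := gHeat_decay F 0
  refine ⟨|Real.log c| + α + C, by positivity, fun t ht x =>
    abs_log_le hα hc hC (norm_nonneg x) (hb t ht x) ?_⟩
  have := hup t ht x
  simp only [wt, pow_zero, inv_one, mul_one] at this
  exact (le_abs_self _).trans this

lemma quadGrowth_log (F : SchwartzMap (Eucl n) ℝ) (hF : GaussLower F) :
    QuadGrowth fun x => Real.log (F x) := by
  have hp := hF.pos
  refine ⟨F.continuous.log fun x => (hp x).ne', ?_⟩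
  obtain ⟨α, c, hα, hc, hb⟩ := hF
  obtain ⟨C, hC, hup⟩ := schwartz_decay F 0
  refine ⟨|Real.log c| + α + C, by positivity, fun x =>
    abs_log_le hα hc hC (norm_nonneg x) (hb x) ?_⟩
  have := hup x
  simp only [wt, pow_zero, inv_one, mul_one] at this
  exact (le_abs_self _).trans this

lemma gHeat_zero (w : Eucl n → ℝ) : gHeat 0 w = w := by
  ext x; simp [gHeat]

lemma continuous_gHeat (F : SchwartzMap (Eucl n) ℝ) (t : ℝ) : Continuous (gHeat t F) :=
  continuous_iff_continuousAt.2 fun x => (hasFDerivAt_gHeat F t x).continuousAt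

lemma exists_schwartz_mul (F G : SchwartzMap (Eucl n) ℝ) :
    ∃ H : SchwartzMap (Eucl n) ℝ, ∀ x, H x = F x * G x :=
  ⟨SchwartzMap.pairing (ContinuousLinearMap.mul ℝ ℝ) F G, fun _ => rfl⟩

lemma hasDerivWithinAt_Ioi_zero_iff {φ : ℝ → ℝ} {d : ℝ} :
    HasDerivWithinAt φ d (Ioi 0) 0 ↔
      Tendsto (fun t => (φ t - φ 0) / t) (𝓝[>] 0) (𝓝 d) := by
  rw [hasDerivWithinAt_iff_tendsto_slope' (by simp)]
  refine tendsto_congr fun t => ?_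
  rw [slope_def_field, sub_zero]

/-- Differentiation under the integral, from the right at `0`. -/
lemma tendsto_integral_div {d : ℝ → Eucl n → ℝ} {d0 B : Eucl n → ℝ}
    (hm : ∀ t ∈ Ioc (0 : ℝ) 1, Continuous (d t))
    (hb : ∀ t ∈ Ioc (0 : ℝ) 1, ∀ x, |d t x| ≤ t * B x) (hB : Integrable B)
    (hlim : ∀ x, Tendsto (fun t => d t x / t) (𝓝[>] 0) (𝓝 (d0 x))) :
    Tendsto (fun t => (∫ x, d t x) / t) (𝓝[>] 0) (𝓝 (∫ x, d0 x)) := by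
  simp_rw [← integral_div]
  refine tendsto_integral_filter_of_dominated_convergence B ?_ ?_ hB (ae_of_all _ hlim)
  · filter_upwards [Ioc_zero_one_mem] with t ht
    exact ((hm t ht).div_const t).aestronglyMeasurable
  · filter_upwards [Ioc_zero_one_mem] with t ht
    refine ae_of_all _ fun x => ?_
    rw [Real.norm_eq_abs, abs_div, abs_of_pos ht.1, div_le_iff₀ ht.1, mul_comm]
    exact hb t ht x

lemma abs_mul_log_sub_le {a b M : ℝ} (ha : 0 < a) (hb : 0 < b) (hla : |Real.log a| ≤ M)
    (hlb : |Real.log b| ≤ M) :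
    |b * Real.log b - a * Real.log a| ≤ (1 + M) * |b - a| := by
  have key : ∀ {a b : ℝ}, 0 < a → 0 < b → |Real.log b| ≤ M →
      b * Real.log b - a * Real.log a ≤ (1 + M) * |b - a| := fun {a b} ha hb hlb => by
    have h1 := Real.log_le_sub_one_of_pos (div_pos hb ha)
    rw [Real.log_div hb.ne' ha.ne'] at h1
    have h2 := mul_le_mul_of_nonneg_left h1 ha.le
    have h3 : a * (b / a - 1) = b - a := by field_simp
    have h4 : (1 + Real.log b) * (b - a) ≤ |1 + Real.log b| * |b - a| := by
      rw [← abs_mul]; exact le_abs_self _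
    have h5 : |1 + Real.log b| ≤ 1 + M := (abs_add_le _ _).trans (by simpa using hlb)
    have h6 := mul_le_mul_of_nonneg_right h5 (abs_nonneg (b - a))
    nlinarith
  rw [abs_le]
  have := key hb ha hla
  rw [abs_sub_comm] at this
  exact ⟨by linarith, key ha hb hlb⟩

/-- Right derivative at `0` of the entropy along a curve of densities. -/
lemma hasDerivWithinAt_entDens {ρ : ℝ → Eucl n → ℝ} {d : Eucl n → ℝ} {K C : ℝ}
    (hK : 0 ≤ K)
    (hpos : ∀ t ∈ Icc (0 : ℝ) 1, ∀ x, 0 < ρ t x)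
    (hcont : ∀ t ∈ Icc (0 : ℝ) 1, Continuous (ρ t))
    (hlog : ∀ t ∈ Icc (0 : ℝ) 1, ∀ x, |Real.log (ρ t x)| ≤ K * (1 + ‖x‖) ^ 2)
    (hdec : RapidDecay (ρ 0))
    (hsub : ∀ t ∈ Icc (0 : ℝ) 1, ∀ x, |ρ t x - ρ 0 x| ≤ t * (C * wt (n + 1 + 2) x))
    (hd : ∀ x, HasDerivWithinAt (fun t => ρ t x) (d x) (Ioi 0) 0) :
    HasDerivWithinAt (fun t => entDens n (ρ t)) (∫ x, (1 + Real.log (ρ 0 x)) * d x)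
      (Ioi 0) 0 := by
  have h0 : (0 : ℝ) ∈ Icc (0 : ℝ) 1 := by simp
  have hcl : ∀ t ∈ Icc (0 : ℝ) 1, Continuous fun x => ρ t x * Real.log (ρ t x) := fun t ht =>
    (hcont t ht).mul ((hcont t ht).log fun x => (hpos t ht x).ne')
  have i0 : Integrable fun x => ρ 0 x * Real.log (ρ 0 x) :=
    (hdec.mul_quadGrowth ⟨(hcont 0 h0).log fun x => (hpos 0 h0 x).ne', K, hK,
      hlog 0 h0⟩).integrable
  have hB : Integrable fun x : Eucl n => (1 + K) * C * wt (n + 1) x :=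
    (integrable_wt (n + 1) (Nat.lt_succ_self n)).const_mul _
  have hb : ∀ t ∈ Icc (0 : ℝ) 1, ∀ x,
      |ρ t x * Real.log (ρ t x) - ρ 0 x * Real.log (ρ 0 x)|
        ≤ t * ((1 + K) * C * wt (n + 1) x) := fun t ht x => by
    refine (abs_mul_log_sub_le (hpos 0 h0 x) (hpos t ht x) (hlog 0 h0 x) (hlog t ht x)).trans ?_
    have hw := wt_pos (n + 1 + 2) x
    have e1 : (1 : ℝ) ≤ (1 + ‖x‖) ^ 2 := one_le_pow₀ (by linarith [norm_nonneg x])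
    calc _ ≤ ((1 + K) * (1 + ‖x‖) ^ 2) * (t * (C * wt (n + 1 + 2) x)) := by
          refine mul_le_mul ?_ (hsub t ht x) (abs_nonneg _) (by positivity)
          linarith
      _ = t * ((1 + K) * C * (wt (n + 1 + 2) x * (1 + ‖x‖) ^ 2)) := by ring
      _ = _ := by rw [wt_mul_pow]
  rw [hasDerivWithinAt_Ioi_zero_iff]
  refine (tendsto_integral_div
    (d := fun t x => ρ t x * Real.log (ρ t x) - ρ 0 x * Real.log (ρ 0 x))
    (fun t ht => (hcl t ⟨ht.1.le, ht.2⟩).sub (hcl 0 h0))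
    (fun t ht => hb t ⟨ht.1.le, ht.2⟩) hB fun x => ?_).congr' ?_
  · rw [← hasDerivWithinAt_Ioi_zero_iff (φ := fun t => ρ t x * Real.log (ρ t x))]
    have := (Real.hasDerivAt_mul_log (hpos 0 h0 x).ne').comp_hasDerivWithinAt 0 (hd x)
    rw [add_comm 1]
    exact this
  · filter_upwards [Ioc_zero_one_mem] with t ht
    have ht' : t ∈ Icc (0 : ℝ) 1 := ⟨ht.1.le, ht.2⟩
    have i1 : Integrable fun x => ρ t x * Real.log (ρ t x) - ρ 0 x * Real.log (ρ 0 x) :=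
      (hB.const_mul t).mono' ((hcl t ht').sub (hcl 0 h0)).aestronglyMeasurable
        (ae_of_all _ (hb t ht'))
    have i2 : Integrable fun x => ρ t x * Real.log (ρ t x) :=
      (i1.add i0).congr (ae_of_all _ fun x => by simp)
    rw [integral_sub i2 i0, entDens, entDens]

/-- Derivative of the entropy along the heat flow. -/
lemma hasDerivWithinAt_entDens_gHeat (v : SchwartzMap (Eucl n) ℝ) (hv : GaussLower v) :
    HasDerivWithinAt (fun t => entDens n (gHeat t v)) (∫ x, (1 + Real.log (v x)) * gen v x)
      (Ioi 0) 0 := by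
  obtain ⟨K, hK, hlog⟩ := log_gHeat_bound v hv
  obtain ⟨α, c, hα, hc, hlow⟩ := gHeat_gaussLower v hv
  obtain ⟨C, -, hsub⟩ := gHeat_sub_bound v (n + 1 + 2)
  have := hasDerivWithinAt_entDens (ρ := fun t => gHeat t v) (d := gen v) hK
    (fun t ht x => lt_of_lt_of_le (by positivity) (hlow t ht.2 x))
    (fun t _ => continuous_gHeat v t) (fun t ht => hlog t ht.2)
    (by simpa only [gHeat_zero] using rapidDecay_schwartz v)
    (by simpa only [gHeat_zero] using hsub) (fun x => by
      rw [hasDerivWithinAt_Ioi_zero_iff]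
      simpa only [gHeat_zero] using tendsto_gHeat_sub_div v x)
  simpa only [gHeat_zero] using this

/-- Derivative of the entropy along the time-reversed entropic interpolation. -/
lemma hasDerivWithinAt_entDens_interp (f g F : SchwartzMap (Eucl n) ℝ) (hf : GaussLower f)
    (hg : GaussLower g) (hF : ⇑F = gHeat 1 f) :
    HasDerivWithinAt (fun t => entDens n fun x => gHeat (1 - t) f x * gHeat t g x)
      (∫ x, (1 + Real.log (F x * g x)) * (F x * gen g x - g x * gen F x)) (Ioi 0) 0 := by
  obtain ⟨K1, hK1, hlog1⟩ := log_gHeat_bound f hf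
  obtain ⟨K2, hK2, hlog2⟩ := log_gHeat_bound g hg
  obtain ⟨α, c, hα, hc, hlow1⟩ := gHeat_gaussLower f hf
  obtain ⟨β, b, hβ, hb, hlow2⟩ := gHeat_gaussLower g hg
  obtain ⟨C1, hC1, hsub1⟩ := gHeat_one_sub_bound f (n + 1 + 2)
  obtain ⟨C2, hC2, hsub2⟩ := gHeat_sub_bound g (n + 1 + 2)
  obtain ⟨A, hA, hgb⟩ := gHeat_decay g 0
  obtain ⟨B, hB, hFb⟩ := gHeat_decay f 0
  simp only [wt, pow_zero, inv_one, mul_one] at hgb hFb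
  have p1 : ∀ t ≤ (1 : ℝ), ∀ x, 0 < gHeat t f x := fun t ht x =>
    lt_of_lt_of_le (by positivity) (hlow1 t ht x)
  have p2 : ∀ t ≤ (1 : ℝ), ∀ x, 0 < gHeat t g x := fun t ht x =>
    lt_of_lt_of_le (by positivity) (hlow2 t ht x)
  have := hasDerivWithinAt_entDens (ρ := fun t x => gHeat (1 - t) f x * gHeat t g x)
    (d := fun x => F x * gen g x - g x * gen F x) (K := K1 + K2) (C := C1 * A + B * C2)
    (by positivity)
    (fun t ht x => mul_pos (p1 _ (by linarith [ht.1]) x) (p2 _ ht.2 x))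
    (fun t _ => (continuous_gHeat f _).mul (continuous_gHeat g t))
    (fun t ht x => by
      rw [Real.log_mul (p1 _ (by linarith [ht.1]) x).ne' (p2 _ ht.2 x).ne', add_mul]
      exact (abs_add_le _ _).trans (add_le_add (hlog1 _ (by linarith [ht.1]) x) (hlog2 t ht.2 x)))
    (by
      simp only [sub_zero, gHeat_zero, ← hF]
      exact (rapidDecay_schwartz F).mul (rapidDecay_schwartz g))
    (fun t ht x => by
      simp only [sub_zero, gHeat_zero]
      have e1 := hsub1 t ht x
      have e2 := hsub2 t ht x
      have e3 := hgb t ht.2 x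
      have e4 := hFb 1 le_rfl x
      rw [Real.norm_eq_abs] at e3 e4
      have hw := wt_pos (n + 1 + 2) x
      have ht0 := ht.1
      calc |gHeat (1 - t) f x * gHeat t g x - gHeat 1 f x * g x|
          = |(gHeat (1 - t) f x - gHeat 1 f x) * gHeat t g x
            + gHeat 1 f x * (gHeat t g x - g x)| := by congr 1; ring
        _ ≤ |gHeat (1 - t) f x - gHeat 1 f x| * |gHeat t g x|
            + |gHeat 1 f x| * |gHeat t g x - g x| := by
            rw [← abs_mul, ← abs_mul]; exact abs_add_le _ _
        _ ≤ (t * (C1 * wt (n + 1 + 2) x)) * A + B * (t * (C2 * wt (n + 1 + 2) x)) := by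
            gcongr
        _ = _ := by ring)
    (fun x => by
      have e1 : HasDerivWithinAt (fun t => gHeat (1 - t) f x) (-gen F x) (Ioi 0) 0 := by
        rw [hasDerivWithinAt_Ioi_zero_iff, sub_zero]
        exact tendsto_gHeat_one_sub_div f F hF x
      have e2 : HasDerivWithinAt (fun t => gHeat t g x) (gen g x) (Ioi 0) 0 := by
        rw [hasDerivWithinAt_Ioi_zero_iff]
        simpa only [gHeat_zero] using tendsto_gHeat_sub_div g x
      refine (e1.mul e2).congr_deriv ?_
      simp only [sub_zero, gHeat_zero, ← hF]
      ring)
  simpa only [gHeat_zero, sub_zero, ← hF] using this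

/-- Left derivative at time `1` of the entropy along the entropic interpolation. -/
lemma derivWithin_entInterp (f g F : SchwartzMap (Eucl n) ℝ) (hf : GaussLower f)
    (hg : GaussLower g) (hF : ⇑F = gHeat 1 f) :
    derivWithin (fun s => entDens n (entInterp n f g s)) (Icc 0 1) 1
      = -∫ x, (1 + Real.log (F x * g x)) * (F x * gen g x - g x * gen F x) := by
  set D := ∫ x, (1 + Real.log (F x * g x)) * (F x * gen g x - g x * gen F x) with hD
  have h := (hasDerivWithinAt_entDens_interp f g F hf hg hF).Ici_of_Ioi
  have h1 : HasDerivWithinAt (fun s : ℝ => 1 - s) (-1) (Icc 0 1) 1 :=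
    ((hasDerivAt_id (1 : ℝ)).const_sub 1).hasDerivWithinAt
  have h2 := HasDerivWithinAt.scomp (1 : ℝ) (t' := Ici 0) (by simpa using h) h1
    (fun s hs => by simpa using hs.2)
  rw [neg_one_smul] at h2
  refine (h2.congr (fun s hs => ?_) ?_).derivWithin (uniqueDiffOn_Icc zero_lt_one 1 (by simp))
  · simp only [Function.comp, sub_sub_cancel]
    congr 1
    ext x
    rw [entInterp, heat_eq_gHeat hs.1, heat_eq_gHeat (by linarith [hs.2])]
  · simp only [Function.comp, sub_sub_cancel]
    congr 1
    ext x
    rw [entInterp, heat_eq_gHeat zero_le_one, heat_eq_gHeat (by simp)]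

/-- Derivative of the integral of a function of quadratic growth along the heat flow. -/
lemma tendsto_integral_gHeat_sub_mul_div (v : SchwartzMap (Eucl n) ℝ) {k : Eucl n → ℝ}
    (hk : QuadGrowth k) :
    Tendsto (fun t => (∫ x, (gHeat t v x - v x) * k x) / t) (𝓝[>] 0)
      (𝓝 (∫ x, gen v x * k x)) := by
  obtain ⟨K, hK, hkb⟩ := hk.2
  obtain ⟨C, hC, hsub⟩ := gHeat_sub_bound v (n + 1 + 2)
  refine tendsto_integral_div (B := fun x => C * K * wt (n + 1) x)
    (fun t _ => ((continuous_gHeat v t).sub v.continuous).mul hk.1) (fun t ht x => ?_)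
    ((integrable_wt (n + 1) (Nat.lt_succ_self n)).const_mul _) fun x => ?_
  · rw [abs_mul, ← wt_mul_pow (n + 1) 2]
    have hw := wt_pos (n + 1 + 2) x
    have ht0 := ht.1.le
    calc _ ≤ (t * (C * wt (n + 1 + 2) x)) * (K * (1 + ‖x‖) ^ 2) :=
          mul_le_mul (hsub t ⟨ht0, ht.2⟩ x) (hkb x) (abs_nonneg _) (by positivity)
      _ = _ := by ring
  · refine ((tendsto_gHeat_sub_div v x).mul_const (k x)).congr fun t => ?_
    ring

lemma withDensity_ofReal_div {X : Type} [MeasurableSpace X] (m : Measure X) {p q : X → ℝ}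
    (hp : Measurable p) (hq : Measurable q) (hp0 : ∀ x, 0 < p x) :
    (m.withDensity fun x => ENNReal.ofReal (p x)).withDensity
        (fun x => ENNReal.ofReal (q x / p x))
      = m.withDensity fun x => ENNReal.ofReal (q x) := by
  rw [← withDensity_mul _ hp.ennreal_ofReal
    (show Measurable fun x => ENNReal.ofReal (q x / p x) from (hq.div hp).ennreal_ofReal)]
  congr 1
  ext x
  rw [Pi.mul_apply, ← ENNReal.ofReal_mul (hp0 x).le, mul_div_cancel₀ _ (hp0 x).ne']

lemma relEnt_withDensity {X : Type} [MeasurableSpace X] (m : Measure X) [SigmaFinite m]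
    {p q : X → ℝ} (hp : Measurable p) (hq : Measurable q) (hp0 : ∀ x, 0 < p x)
    (hq0 : ∀ x, 0 < q x) (hi : Integrable (fun x => q x * Real.log (q x / p x)) m) :
    relEnt (m.withDensity fun x => ENNReal.ofReal (q x))
        (m.withDensity fun x => ENNReal.ofReal (p x))
      = ((∫ x, q x * Real.log (q x / p x) ∂m : ℝ) : EReal) := by
  set ν := m.withDensity fun x => ENNReal.ofReal (p x) with hR
  set π := m.withDensity fun x => ENNReal.ofReal (q x) with hπ
  have : SigmaFinite ν := SigmaFinite.withDensity_ofReal p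
  have e : ν.withDensity (fun x => ENNReal.ofReal (q x / p x)) = π :=
    withDensity_ofReal_div m hp hq hp0
  have hac : π ≪ ν := e ▸ withDensity_absolutelyContinuous _ _
  have hrn : ∀ᵐ x ∂π, Real.log (π.rnDeriv ν x).toReal = Real.log (q x / p x) := by
    have h := Measure.rnDeriv_withDensity ν (hq.div hp).ennreal_ofReal
    rw [show ν.withDensity (fun x => ENNReal.ofReal ((q / p) x)) = π from e] at h
    filter_upwards [hac.ae_le h] with x hx
    rw [hx, ENNReal.toReal_ofReal]
    · rfl
    · exact (div_pos (hq0 x) (hp0 x)).le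
  have hi' : Integrable (fun x => Real.log (q x / p x)) π := by
    rw [hπ, integrable_withDensity_iff_integrable_smul' hq.ennreal_ofReal
      (ae_of_all _ fun x => ENNReal.ofReal_lt_top)]
    refine hi.congr (ae_of_all _ fun x => ?_)
    simp only [ENNReal.toReal_ofReal (hq0 x).le, smul_eq_mul]
  rw [relEnt, if_pos ⟨hac, hi'.congr (hrn.mono fun x hx => hx.symm)⟩, integral_congr_ae hrn, hπ,
    integral_withDensity_eq_integral_toReal_smul hq.ennreal_ofReal
      (ae_of_all _ fun x => ENNReal.ofReal_lt_top)]
  simp only [ENNReal.toReal_ofReal (hq0 _).le, smul_eq_mul]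

/-- Gibbs' inequality: among subprobability densities, the true one maximises `∫ log k dπ`. -/
lemma integral_log_le_of_lintegral_le_one {X : Type} [MeasurableSpace X] (π ν : Measure X)
    [IsProbabilityMeasure π] [SigmaFinite ν] (hac : π ≪ ν) {k : X → ℝ} (hk : Measurable k)
    (hk0 : ∀ x, 0 < k x) (hk1 : ∫⁻ x, ENNReal.ofReal (k x) ∂ν ≤ 1)
    (hik : Integrable (fun x => Real.log (k x)) π)
    (hih : Integrable (fun x => Real.log (π.rnDeriv ν x).toReal) π) :
    ∫ x, Real.log (k x) ∂π ≤ ∫ x, Real.log (π.rnDeriv ν x).toReal ∂π := by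
  have hm := Measure.measurable_rnDeriv π ν
  have hφm : Measurable fun x => k x / (π.rnDeriv ν x).toReal := hk.div hm.ennreal_toReal
  have hφ0 : ∀ x, 0 ≤ k x / (π.rnDeriv ν x).toReal := fun x =>
    div_nonneg (hk0 x).le ENNReal.toReal_nonneg
  have hl : ∫⁻ x, ENNReal.ofReal (k x / (π.rnDeriv ν x).toReal) ∂π ≤ 1 := by
    calc _ = ∫⁻ x, ENNReal.ofReal (k x / (π.rnDeriv ν x).toReal)
          ∂(ν.withDensity (π.rnDeriv ν)) := by rw [Measure.withDensity_rnDeriv_eq π ν hac]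
      _ = ∫⁻ x, π.rnDeriv ν x * ENNReal.ofReal (k x / (π.rnDeriv ν x).toReal) ∂ν :=
          lintegral_withDensity_eq_lintegral_mul _ hm hφm.ennreal_ofReal
      _ ≤ ∫⁻ x, ENNReal.ofReal (k x) ∂ν := by
          refine lintegral_mono_ae ?_
          filter_upwards [Measure.rnDeriv_lt_top π ν] with x hx
          rw [← ENNReal.ofReal_toReal hx.ne, ← ENNReal.ofReal_mul ENNReal.toReal_nonneg,
            ENNReal.toReal_ofReal ENNReal.toReal_nonneg]
          refine ENNReal.ofReal_le_ofReal ?_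
          by_cases h : (π.rnDeriv ν x).toReal = 0
          · rw [h, zero_mul]; exact (hk0 x).le
          · rw [mul_div_cancel₀ _ h]
      _ ≤ 1 := hk1
  have hiφ : Integrable (fun x => k x / (π.rnDeriv ν x).toReal) π :=
    ⟨hφm.aestronglyMeasurable, by
      rw [hasFiniteIntegral_iff_ofReal (ae_of_all _ hφ0)]
      exact hl.trans_lt ENNReal.one_lt_top⟩
  have hφ1 : ∫ x, k x / (π.rnDeriv ν x).toReal ∂π ≤ 1 := by
    rw [integral_eq_lintegral_of_nonneg_ae (ae_of_all _ hφ0) hφm.aestronglyMeasurable]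
    exact ENNReal.toReal_le_of_le_ofReal zero_le_one (by simpa using hl)
  have hmono : ∫ x, (Real.log (k x) - Real.log (π.rnDeriv ν x).toReal) ∂π
      ≤ ∫ x, (k x / (π.rnDeriv ν x).toReal - 1) ∂π := by
    refine integral_mono_ae (hik.sub hih) (hiφ.sub (integrable_const 1)) ?_
    filter_upwards [Measure.rnDeriv_pos hac, hac.ae_le (Measure.rnDeriv_lt_top π ν)]
      with x hx hx'
    have h := ENNReal.toReal_pos hx.ne' hx'.ne
    rw [← Real.log_div (hk0 x).ne' h.ne']
    exact Real.log_le_sub_one_of_pos (div_pos (hk0 x) h)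
  rw [integral_sub hik hih, integral_sub hiφ (integrable_const 1), integral_const] at hmono
  simp only [probReal_univ, smul_eq_mul, mul_one] at hmono
  linarith

lemma entLeb_densMeas {ρ : Eucl n → ℝ} (hρ : Measurable ρ) (h0 : ∀ x, 0 ≤ ρ x) :
    entLeb n (densMeas n ρ) = entDens n ρ := by
  rw [entLeb, entDens, densMeas]
  refine integral_congr_ae ?_
  filter_upwards [Measure.rnDeriv_withDensity volume hρ.ennreal_ofReal] with x hx
  rw [hx, ENNReal.toReal_ofReal (h0 x)]

lemma integral_densMeas {ρ : Eucl n → ℝ} (hρ : Measurable ρ) (h0 : ∀ x, 0 ≤ ρ x)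
    (h : Eucl n → ℝ) : ∫ x, h x ∂densMeas n ρ = ∫ x, ρ x * h x := by
  rw [densMeas, integral_withDensity_eq_integral_toReal_smul hρ.ennreal_ofReal
      (ae_of_all _ fun x => ENNReal.ofReal_lt_top)]
  simp only [ENNReal.toReal_ofReal (h0 _), smul_eq_mul]

lemma integrable_densMeas {ρ h : Eucl n → ℝ} (hρ : Measurable ρ) (h0 : ∀ x, 0 ≤ ρ x)
    (hi : Integrable fun x => ρ x * h x) : Integrable h (densMeas n ρ) := by
  rw [densMeas, integrable_withDensity_iff_integrable_smul' hρ.ennreal_ofReal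
      (ae_of_all _ fun x => ENNReal.ofReal_lt_top)]
  simpa only [ENNReal.toReal_ofReal (h0 _), smul_eq_mul] using hi

lemma map_fst_withDensity {q : Eucl n × Eucl n → ℝ} (hq : Measurable q) {u : Eucl n → ℝ}
    (h : ∀ x, ∫⁻ y, ENNReal.ofReal (q (x, y)) = ENNReal.ofReal (u x)) :
    (volume.withDensity fun p => ENNReal.ofReal (q p)).map Prod.fst = densMeas n u := by
  ext s hs
  rw [Measure.map_apply measurable_fst hs, withDensity_apply _ (measurable_fst hs), densMeas,
    withDensity_apply _ hs, ← lintegral_indicator (measurable_fst hs), ← lintegral_indicator hs,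
    Measure.volume_eq_prod, lintegral_prod _ (hq.ennreal_ofReal.indicator
      (measurable_fst hs)).aemeasurable]
  congr 1
  ext x
  by_cases hx : x ∈ s
  · simp [indicator, hx, h]
  · simp [indicator, hx]

lemma map_snd_withDensity {q : Eucl n × Eucl n → ℝ} (hq : Measurable q) {v : Eucl n → ℝ}
    (h : ∀ y, ∫⁻ x, ENNReal.ofReal (q (x, y)) = ENNReal.ofReal (v y)) :
    (volume.withDensity fun p => ENNReal.ofReal (q p)).map Prod.snd = densMeas n v := by
  ext s hs
  rw [Measure.map_apply measurable_snd hs, withDensity_apply _ (measurable_snd hs), densMeas,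
    withDensity_apply _ hs, ← lintegral_indicator (measurable_snd hs), ← lintegral_indicator hs,
    Measure.volume_eq_prod, lintegral_prod_symm _ (hq.ennreal_ofReal.indicator
      (measurable_snd hs)).aemeasurable]
  congr 1
  ext x
  by_cases hx : x ∈ s
  · simp [indicator, hx, h]
  · simp [indicator, hx]

/-- A kernel with the right marginal densities defines a coupling. -/
lemma coupling_withDensity {q : Eucl n × Eucl n → ℝ} (hq : Measurable q) {u v : Eucl n → ℝ}
    (hu : IsProbabilityMeasure (densMeas n u))
    (h1 : ∀ x, ∫⁻ y, ENNReal.ofReal (q (x, y)) = ENNReal.ofReal (u x))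
    (h2 : ∀ y, ∫⁻ x, ENNReal.ofReal (q (x, y)) = ENNReal.ofReal (v y)) :
    Coupling (volume.withDensity fun p => ENNReal.ofReal (q p)) (densMeas n u) (densMeas n v) := by
  have e := map_fst_withDensity hq h1
  refine ⟨⟨?_⟩, e, map_snd_withDensity hq h2⟩
  have := hu.measure_univ
  rwa [← e, Measure.map_apply measurable_fst MeasurableSet.univ, preimage_univ] at this

lemma log_gaussDens (a : Eucl n) :
    Real.log (gaussDens n a) = -‖a‖ ^ 2 / 2 - Real.log ((2 * Real.pi) ^ ((n : ℝ) / 2)) := by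
  rw [gaussDens, Real.log_div (Real.exp_pos _).ne' (by positivity), Real.log_exp]

lemma abs_log_gaussDens_le (n : ℕ) :
    ∃ K, 0 ≤ K ∧ ∀ a : Eucl n, |Real.log (gaussDens n a)| ≤ K * (1 + ‖a‖) ^ 2 := by
  refine ⟨1 + |Real.log ((2 * Real.pi) ^ ((n : ℝ) / 2))|, by positivity, fun a => ?_⟩
  rw [log_gaussDens]
  set κ := Real.log ((2 * Real.pi) ^ ((n : ℝ) / 2))
  have h1 := le_abs_self κ
  have h2 := neg_abs_le κ
  have h3 := norm_nonneg a
  have h4 := abs_nonneg κ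
  rw [abs_le]
  constructor <;> nlinarith [mul_nonneg h4 h3, mul_nonneg h4 (sq_nonneg ‖a‖)]

lemma gaussDens_le (n : ℕ) (a : Eucl n) : gaussDens n a ≤ gaussDens n 0 := by
  unfold gaussDens
  gcongr
  simp

/-- Positive continuous kernels with rapid decay and logarithm of polynomial growth. -/
structure GoodKernel (Q : Eucl n × Eucl n → ℝ) : Prop where
  cont : Continuous Q
  pos : ∀ p, 0 < Q p
  decay : ∀ N, ∃ C, 0 ≤ C ∧ ∀ p, Q p ≤ C * (wt N p.1 * wt N p.2)
  log : ∃ K, 0 ≤ K ∧ ∀ p, |Real.log (Q p)| ≤ K * ((1 + ‖p.1‖) ^ 2 * (1 + ‖p.2‖) ^ 2)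

lemma integrable_wt_prod (n : ℕ) :
    Integrable fun p : Eucl n × Eucl n => wt (n + 1) p.1 * wt (n + 1) p.2 :=
  (integrable_wt (n + 1) (Nat.lt_succ_self n)).mul_prod
    (integrable_wt (n + 1) (Nat.lt_succ_self n))

lemma GoodKernel.exists_mul_le {Q : Eucl n × Eucl n → ℝ} (hQ : GoodKernel Q) :
    ∃ C, 0 ≤ C ∧ ∀ p, Q p * ((1 + ‖p.1‖) ^ 2 * (1 + ‖p.2‖) ^ 2)
      ≤ C * (wt (n + 1) p.1 * wt (n + 1) p.2) := by
  obtain ⟨C, hC, h⟩ := hQ.decay (n + 1 + 2)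
  refine ⟨C, hC, fun p => ?_⟩
  rw [← wt_mul_pow (n + 1) 2 p.1, ← wt_mul_pow (n + 1) 2 p.2]
  calc _ ≤ C * (wt (n + 1 + 2) p.1 * wt (n + 1 + 2) p.2)
        * ((1 + ‖p.1‖) ^ 2 * (1 + ‖p.2‖) ^ 2) := by gcongr; exact h p
    _ = _ := by ring

lemma GoodKernel.integrable_mul {Q h : Eucl n × Eucl n → ℝ} (hQ : GoodKernel Q)
    (hc : Continuous h) {K : ℝ} (hK : 0 ≤ K)
    (hb : ∀ p, |h p| ≤ K * ((1 + ‖p.1‖) ^ 2 * (1 + ‖p.2‖) ^ 2)) :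
    Integrable fun p => Q p * h p := by
  obtain ⟨C, hC, hQC⟩ := hQ.exists_mul_le
  refine ((integrable_wt_prod n).const_mul (K * C)).mono'
    (hQ.cont.mul hc).aestronglyMeasurable (ae_of_all _ fun p => ?_)
  rw [Real.norm_eq_abs, abs_mul, abs_of_pos (hQ.pos p)]
  calc Q p * |h p| ≤ Q p * (K * ((1 + ‖p.1‖) ^ 2 * (1 + ‖p.2‖) ^ 2)) := by
        have := (hQ.pos p).le
        gcongr
        exact hb p
    _ = K * (Q p * ((1 + ‖p.1‖) ^ 2 * (1 + ‖p.2‖) ^ 2)) := by ring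
    _ ≤ K * (C * (wt (n + 1) p.1 * wt (n + 1) p.2)) := mul_le_mul_of_nonneg_left (hQC p) hK
    _ = _ := by ring

lemma one_add_norm_add_le (x y : Eucl n) : 1 + ‖x + y‖ ≤ (1 + ‖x‖) * (1 + ‖y‖) := by
  nlinarith [norm_add_le x y, mul_nonneg (norm_nonneg x) (norm_nonneg y)]

lemma one_add_norm_add_sqrt_smul_le {t : ℝ} (ht : t ≤ 1) (x z : Eucl n) :
    (1 + ‖x + √t • z‖) ^ 2 ≤ (1 + ‖x‖) ^ 2 * (1 + ‖z‖) ^ 2 := by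
  rw [← mul_pow]
  refine pow_le_pow_left₀ (by positivity) ((one_add_norm_add_le _ _).trans ?_) 2
  gcongr
  exact norm_sqrt_smul_le ht z

/-- Jensen's inequality for the entropy of a Gaussian average. -/
lemma gaussian_average_entropy {a : Eucl n → ℝ} (hc : Continuous a) (hpos : ∀ z, 0 < a z)
    {C K : ℝ} (hC : ∀ z, a z ≤ C) (hK : ∀ z, |Real.log (a z)| ≤ K * (1 + ‖z‖) ^ 2) :
    0 < ∫ z, a z ∂stdG n ∧
    |Real.log (∫ z, a z ∂stdG n)| ≤ K * ∫ z, (1 + ‖z‖) ^ 2 ∂stdG n + C ∧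
    ∀ b, (∫ z, a z ∂stdG n) * (Real.log (∫ z, a z ∂stdG n) - b)
      ≤ ∫ z, a z * (Real.log (a z) - b) ∂stdG n := by
  have hlc : Continuous fun z => Real.log (a z) := hc.log fun z => (hpos z).ne'
  have hia : Integrable a (stdG n) := (integrable_const C).mono' hc.aestronglyMeasurable
    (ae_of_all _ fun z => by rw [Real.norm_of_nonneg (hpos z).le]; exact hC z)
  have hil : Integrable (fun z => Real.log (a z)) (stdG n) := integrable_stdG_of_bound hlc hK
  have hial : Integrable (fun z => a z * Real.log (a z)) (stdG n) :=
    integrable_stdG_of_bound (C := C * K) (hc.mul hlc) fun z => by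
      rw [abs_mul, abs_of_pos (hpos z), mul_assoc]
      exact mul_le_mul (hC z) (hK z) (abs_nonneg _) ((hpos z).le.trans (hC z))
  have hq : 0 < ∫ z, a z ∂stdG n := by
    have e : ∀ z, a z = Real.exp (Real.log (a z)) := fun z => (Real.exp_log (hpos z)).symm
    rw [integral_congr_ae (ae_of_all _ e)]
    exact integral_exp_pos (hia.congr (ae_of_all _ e))
  set q := ∫ z, a z ∂stdG n with hqdef
  have hqC : q ≤ C := by
    refine (integral_mono hia (integrable_const C) hC).trans_eq ?_
    simp
  refine ⟨hq, ?_, fun b => ?_⟩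
  · have hint0 : 0 ≤ ∫ z : Eucl n, (1 + ‖z‖) ^ 2 ∂stdG n := by positivity
    have hK0 : 0 ≤ K := by simpa using (abs_nonneg _).trans (hK 0)
    have h1 : ∫ z, Real.log (a z) ∂stdG n ≤ Real.log q := by
      have h2 : ∫ z, Real.log (a z) ∂stdG n ≤ ∫ z, (Real.log q - 1 + q⁻¹ * a z) ∂stdG n := by
        refine integral_mono hil ((integrable_const _).add (hia.const_mul _)) fun z => ?_
        have := Real.log_le_sub_one_of_pos (div_pos (hpos z) hq)
        rw [Real.log_div (hpos z).ne' hq.ne', div_eq_inv_mul] at this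
        linarith
      rw [integral_add (integrable_const _) (hia.const_mul _), integral_const_mul, ← hqdef,
        inv_mul_cancel₀ hq.ne'] at h2
      simpa using h2
    have h3 : -(K * ∫ z, (1 + ‖z‖) ^ 2 ∂stdG n) ≤ ∫ z, Real.log (a z) ∂stdG n := by
      rw [← integral_const_mul, ← integral_neg]
      exact integral_mono ((integrable_one_add_norm_pow_stdG n 2).const_mul K).neg hil
        fun z => (abs_le.1 (hK z)).1
    have h4 := Real.log_le_sub_one_of_pos hq
    have h5 := mul_nonneg hK0 hint0
    rw [abs_le]
    constructor <;> linarith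
  · have h2 : ∫ z, ((1 + Real.log q - b) * a z - q) ∂stdG n
        ≤ ∫ z, a z * (Real.log (a z) - b) ∂stdG n := by
      refine integral_mono ((hia.const_mul _).sub (integrable_const q))
        ((hial.sub (hia.const_mul b)).congr (ae_of_all _ fun z => ?_)) fun z => ?_
      · simp only [Pi.sub_apply]; ring
      · have h := Real.log_le_sub_one_of_pos (div_pos hq (hpos z))
        rw [Real.log_div hq.ne' (hpos z).ne'] at h
        have h' := mul_le_mul_of_nonneg_left h (hpos z).le
        have h3 : a z * (q / a z - 1) = q - a z := by have := (hpos z).ne'; field_simp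
        nlinarith
    rw [integral_sub (hia.const_mul _) (integrable_const q), integral_const_mul, ← hqdef] at h2
    simp only [integral_const, probReal_univ, smul_eq_mul, one_mul] at h2
    linarith

/-- Heat flow in the second variable of a kernel. -/
def smear (t : ℝ) (Q : Eucl n × Eucl n → ℝ) (p : Eucl n × Eucl n) : ℝ :=
  ∫ z, Q (p.1, p.2 + √t • z) ∂stdG n

lemma GoodKernel.log_slice {Q : Eucl n × Eucl n → ℝ} (hQ : GoodKernel Q) :
    ∃ K, 0 ≤ K ∧ ∀ t ≤ (1 : ℝ), ∀ p : Eucl n × Eucl n, ∀ z,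
    |Real.log (Q (p.1, p.2 + √t • z))|
      ≤ K * ((1 + ‖p.1‖) ^ 2 * (1 + ‖p.2‖) ^ 2) * (1 + ‖z‖) ^ 2 := by
  obtain ⟨K, hK, h⟩ := hQ.log
  refine ⟨K, hK, fun t ht p z => (h _).trans ?_⟩
  rw [mul_assoc, mul_assoc]
  gcongr
  exact one_add_norm_add_sqrt_smul_le ht _ _

lemma GoodKernel.decay_slice {Q : Eucl n × Eucl n → ℝ} (hQ : GoodKernel Q)
    (N : ℕ) : ∃ C, 0 ≤ C ∧ ∀ t ≤ (1 : ℝ), ∀ p : Eucl n × Eucl n, ∀ z,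
    Q (p.1, p.2 + √t • z) ≤ C * (wt N p.1 * wt N p.2) * (1 + ‖z‖) ^ N := by
  obtain ⟨C, hC, h⟩ := hQ.decay N
  refine ⟨C, hC, fun t ht p z => (h _).trans ?_⟩
  have := (wt_pos N p.1).le
  calc _ ≤ C * (wt N p.1 * ((1 + ‖z‖) ^ N * wt N p.2)) := by
        gcongr; exact wt_add_sqrt_smul_le N ht _ _
    _ = _ := by ring

lemma GoodKernel.exists_bound {Q : Eucl n × Eucl n → ℝ} (hQ : GoodKernel Q) :
    ∃ C, 0 ≤ C ∧ ∀ p, Q p ≤ C := by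
  obtain ⟨C, hC, h⟩ := hQ.decay 0
  exact ⟨C, hC, by simpa [wt] using h⟩

lemma GoodKernel.integrable_slice {Q : Eucl n × Eucl n → ℝ} (hQ : GoodKernel Q)
    (t : ℝ) (p : Eucl n × Eucl n) :
    Integrable (fun z => Q (p.1, p.2 + √t • z)) (stdG n) := by
  obtain ⟨C, hC, h⟩ := hQ.exists_bound
  have := hQ.cont
  exact (integrable_const C).mono' (Continuous.aestronglyMeasurable (by fun_prop))
    (ae_of_all _ fun z => by rw [Real.norm_of_nonneg (hQ.pos _).le]; exact h _)

lemma GoodKernel.smear_entropy_slice {Q : Eucl n × Eucl n → ℝ} (hQ : GoodKernel Q)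
    {t : ℝ} (ht : t ≤ 1) (p : Eucl n × Eucl n) (b : ℝ) :
    smear t Q p * (Real.log (smear t Q p) - b)
      ≤ ∫ z, Q (p.1, p.2 + √t • z) * (Real.log (Q (p.1, p.2 + √t • z)) - b) ∂stdG n := by
  obtain ⟨K, hK, hl⟩ := hQ.log_slice
  obtain ⟨C, hC, hC'⟩ := hQ.exists_bound
  have := hQ.cont
  exact (gaussian_average_entropy (a := fun z => Q (p.1, p.2 + √t • z)) (by fun_prop)
    (fun z => hQ.pos _) (fun z => hC' _) (hl t ht p)).2.2 b

lemma GoodKernel.smear {Q : Eucl n × Eucl n → ℝ} (hQ : GoodKernel Q)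
    {t : ℝ} (ht : t ≤ 1) : GoodKernel (smear t Q) := by
  obtain ⟨K, hK, hl⟩ := hQ.log_slice
  obtain ⟨C, hC, hC'⟩ := hQ.exists_bound
  have hcont := hQ.cont
  have hG := fun p : Eucl n × Eucl n => gaussian_average_entropy
    (a := fun z => Q (p.1, p.2 + √t • z)) (by fun_prop) (fun z => hQ.pos _) (fun z => hC' _)
    (hl t ht p)
  refine ⟨?_, fun p => (hG p).1, fun N => ?_, ?_⟩
  · refine continuous_of_dominated (bound := fun _ => C) (fun p => Continuous.aestronglyMeasurable
      (by fun_prop)) (fun p => ae_of_all _ fun z => ?_) (integrable_const C)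
      (ae_of_all _ fun z => by fun_prop)
    rw [Real.norm_of_nonneg (hQ.pos _).le]; exact hC' _
  · obtain ⟨D, hD, hd⟩ := hQ.decay_slice N
    refine ⟨D * ∫ z, (1 + ‖z‖) ^ N ∂stdG n, by positivity, fun p => ?_⟩
    refine (integral_mono (hQ.integrable_slice t p)
      ((integrable_one_add_norm_pow_stdG n N).const_mul _) fun z => hd t ht p z).trans_eq ?_
    rw [integral_const_mul]; ring
  · refine ⟨K * (∫ z, (1 + ‖z‖) ^ 2 ∂stdG n) + C, by positivity, fun p => (hG p).2.1.trans ?_⟩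
    have h1 : (1 : ℝ) ≤ (1 + ‖p.1‖) ^ 2 * (1 + ‖p.2‖) ^ 2 :=
      one_le_mul_of_one_le_of_one_le (one_le_pow₀ (by linarith [norm_nonneg p.1]))
        (one_le_pow₀ (by linarith [norm_nonneg p.2]))
    have := mul_le_mul_of_nonneg_left h1 hC
    nlinarith

lemma GoodKernel.ofReal_smear {Q : Eucl n × Eucl n → ℝ} (hQ : GoodKernel Q)
    (t : ℝ) (p : Eucl n × Eucl n) :
    ENNReal.ofReal (HeatFlow.smear t Q p)
      = ∫⁻ z, ENNReal.ofReal (Q (p.1, p.2 + √t • z)) ∂stdG n :=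
  ofReal_integral_eq_lintegral_ofReal (hQ.integrable_slice t p)
    (ae_of_all _ fun _ => (hQ.pos _).le)

lemma GoodKernel.lintegral_smear_right {Q : Eucl n × Eucl n → ℝ} (hQ : GoodKernel Q)
    (t : ℝ) (x : Eucl n) :
    ∫⁻ y, ENNReal.ofReal (HeatFlow.smear t Q (x, y)) = ∫⁻ y, ENNReal.ofReal (Q (x, y)) := by
  have hcont := hQ.cont
  simp_rw [hQ.ofReal_smear]
  rw [lintegral_lintegral_swap]
  · simp_rw [lintegral_add_right_eq_self (fun y => ENNReal.ofReal (Q (x, y)))]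
    simp
  · exact (ENNReal.measurable_ofReal.comp (Continuous.measurable (by fun_prop :
      Continuous fun p : Eucl n × Eucl n => Q (x, p.1 + √t • p.2)))).aemeasurable

lemma GoodKernel.lintegral_smear_left {Q : Eucl n × Eucl n → ℝ} (hQ : GoodKernel Q)
    (t : ℝ) (y : Eucl n) :
    ∫⁻ x, ENNReal.ofReal (HeatFlow.smear t Q (x, y))
      = ∫⁻ z, (∫⁻ x, ENNReal.ofReal (Q (x, y + √t • z))) ∂stdG n := by
  have hcont := hQ.cont
  simp_rw [hQ.ofReal_smear]
  rw [lintegral_lintegral_swap]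
  exact (ENNReal.measurable_ofReal.comp (Continuous.measurable (by fun_prop :
    Continuous fun p : Eucl n × Eucl n => Q (p.1, y + √t • p.2)))).aemeasurable

lemma one_add_norm_sub_le (p : Eucl n × Eucl n) :
    (1 + ‖p.1 - p.2‖) ^ 2 ≤ (1 + ‖p.1‖) ^ 2 * (1 + ‖p.2‖) ^ 2 := by
  rw [← mul_pow]
  refine pow_le_pow_left₀ (by positivity) ?_ 2
  have := one_add_norm_add_le p.1 (-p.2)
  rwa [← sub_eq_add_neg, norm_neg] at this

lemma one_le_growth (p : Eucl n × Eucl n) : 1 ≤ (1 + ‖p.1‖) ^ 2 * (1 + ‖p.2‖) ^ 2 :=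
  one_le_mul_of_one_le_of_one_le (one_le_pow₀ (by linarith [norm_nonneg p.1]))
    (one_le_pow₀ (by linarith [norm_nonneg p.2]))

lemma continuous_log_gaussDens (n : ℕ) : Continuous fun a => Real.log (gaussDens n a) :=
  (continuous_gaussDens n).log fun a => (gaussDens_pos n a).ne'

lemma GoodKernel.continuous_log {Q : Eucl n × Eucl n → ℝ} (hQ : GoodKernel Q) :
    Continuous fun p => Real.log (Q p) := hQ.cont.log fun p => (hQ.pos p).ne'

lemma GoodKernel.integrable {Q : Eucl n × Eucl n → ℝ} (hQ : GoodKernel Q) : Integrable Q := by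
  simpa using hQ.integrable_mul (h := fun _ => 1) continuous_const zero_le_one
    (fun p => by simpa using one_le_growth p)

/-- The entropy integrand relative to the heat kernel is integrable. -/
lemma GoodKernel.integrable_entropy {Q : Eucl n × Eucl n → ℝ} (hQ : GoodKernel Q) :
    Integrable fun p => Q p * (Real.log (Q p) - Real.log (gaussDens n (p.1 - p.2))) := by
  obtain ⟨K, hK, h⟩ := hQ.log
  obtain ⟨L, hL, h'⟩ := abs_log_gaussDens_le n
  refine hQ.integrable_mul (hQ.continuous_log.sub ((continuous_log_gaussDens n).comp (by fun_prop)))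
    (add_nonneg hK hL) fun p => (abs_sub _ _).trans ?_
  rw [add_mul]
  exact add_le_add (h p) ((h' _).trans (mul_le_mul_of_nonneg_left (one_add_norm_sub_le p) hL))

lemma log_gaussDens_add_sqrt_smul {t : ℝ} (ht : 0 ≤ t) (a z : Eucl n) :
    Real.log (gaussDens n (a + √t • z))
      = Real.log (gaussDens n a) - √t * inner ℝ a z - t / 2 * ‖z‖ ^ 2 := by
  rw [log_gaussDens, log_gaussDens, norm_add_sq_real, inner_smul_right, norm_smul, mul_pow,
    Real.norm_of_nonneg (Real.sqrt_nonneg t), Real.sq_sqrt ht]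
  ring

lemma integrable_norm_sq_stdG (n : ℕ) : Integrable (fun z : Eucl n => ‖z‖ ^ 2) (stdG n) :=
  integrable_stdG_of_bound (C := 1) (by fun_prop) fun z => by
    rw [abs_of_nonneg (by positivity), one_mul]
    exact pow_le_pow_left₀ (norm_nonneg z) (by linarith) 2

lemma integral_log_gaussDens_add {t : ℝ} (ht : 0 ≤ t) (a : Eucl n) (q b : ℝ) :
    ∫ z, q * (b - Real.log (gaussDens n (a + √t • z))) ∂stdG n
      = q * (b - Real.log (gaussDens n a) + t / 2 * ∫ z, ‖z‖ ^ 2 ∂stdG n) := by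
  simp_rw [log_gaussDens_add_sqrt_smul ht a]
  have e : ∀ z : Eucl n, b - (Real.log (gaussDens n a) - √t * inner ℝ a z - t / 2 * ‖z‖ ^ 2)
      = (b - Real.log (gaussDens n a) + √t * innerSL ℝ a z) + t / 2 * ‖z‖ ^ 2 := fun z => by
    rw [innerSL_apply_apply]; ring
  have hi : Integrable (fun z => innerSL ℝ a z) (stdG n) :=
    integrable_stdG_of_bound (C := ‖a‖) (innerSL ℝ a).continuous fun z => by
      refine (abs_real_inner_le_norm a z).trans ?_
      have := norm_nonneg z
      gcongr
      nlinarith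
  simp_rw [e]
  rw [integral_const_mul, integral_add
    (f := fun z => b - Real.log (gaussDens n a) + √t * innerSL ℝ a z)
    ((integrable_const _).add (hi.const_mul _)) ((integrable_norm_sq_stdG n).const_mul _),
    integral_add (integrable_const _) (hi.const_mul _), integral_const_mul, integral_const_mul,
    integral_clm_stdG]
  simp

/-- Smearing a kernel by the heat flow increases its entropy at most linearly in time. -/
lemma GoodKernel.smear_entropy_le {Q : Eucl n × Eucl n → ℝ} (hQ : GoodKernel Q) {t : ℝ}
    (ht : t ∈ Icc (0 : ℝ) 1) :
    ∫ p, HeatFlow.smear t Q p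
        * (Real.log (HeatFlow.smear t Q p) - Real.log (gaussDens n (p.1 - p.2)))
      ≤ (∫ p, Q p * (Real.log (Q p) - Real.log (gaussDens n (p.1 - p.2))))
        + t / 2 * (∫ z, ‖z‖ ^ 2 ∂stdG n) * ∫ p, Q p := by
  set G : Eucl n × (Eucl n × Eucl n) → ℝ := fun w =>
    Q w.2 * (Real.log (Q w.2) - Real.log (gaussDens n (w.2.1 - w.2.2 + √t • w.1))) with hG
  set Ψ : Eucl n × (Eucl n × Eucl n) → Eucl n × (Eucl n × Eucl n) := fun w =>
    (w.1, w.2 + (0, √t • w.1)) with hΨ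
  have : (volume : Measure (Eucl n × Eucl n)).IsAddRightInvariant := by
    rw [Measure.volume_eq_prod]
    infer_instance
  have hΨm : MeasurePreserving Ψ ((stdG n).prod volume) ((stdG n).prod volume) :=
    (MeasurePreserving.id (stdG n)).skew_product
      (g := fun z (p : Eucl n × Eucl n) => p + (0, √t • z))
      (Continuous.measurable (by fun_prop))
      (ae_of_all _ fun z => (measurePreserving_add_right volume ((0 : Eucl n), √t • z)).map_eq)
  have hGc : Continuous G := by
    exact (hQ.cont.comp continuous_snd).mul ((hQ.continuous_log.comp continuous_snd).sub
      ((continuous_log_gaussDens n).comp (by fun_prop)))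
  have hGi : Integrable G ((stdG n).prod volume) := by
    obtain ⟨K, hK, h⟩ := hQ.log
    obtain ⟨L, hL, h'⟩ := abs_log_gaussDens_le n
    obtain ⟨C, hC, hQC⟩ := hQ.exists_mul_le
    refine (((integrable_one_add_norm_pow_stdG n 2).const_mul ((K + L) * C)).mul_prod
      (integrable_wt_prod n)).mono' hGc.aestronglyMeasurable (ae_of_all _ fun w => ?_)
    obtain ⟨z, p⟩ := w
    have hz : (1 : ℝ) ≤ (1 + ‖z‖) ^ 2 := one_le_pow₀ (by linarith [norm_nonneg z])
    have h1 : |Real.log (Q p) - Real.log (gaussDens n (p.1 - p.2 + √t • z))|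
        ≤ (K + L) * ((1 + ‖p.1‖) ^ 2 * (1 + ‖p.2‖) ^ 2 * (1 + ‖z‖) ^ 2) := by
      refine (abs_sub _ _).trans ?_
      rw [add_mul]
      refine add_le_add ((h p).trans ?_) ((h' _).trans ?_)
      · exact mul_le_mul_of_nonneg_left (le_mul_of_one_le_right (by positivity) hz) hK
      · gcongr
        exact (one_add_norm_add_sqrt_smul_le ht.2 _ z).trans
          (mul_le_mul_of_nonneg_right (one_add_norm_sub_le p) (by positivity))
    have h2 := (hQ.pos p).le
    rw [Real.norm_eq_abs, hG, abs_mul, abs_of_nonneg h2]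
    calc Q p * |Real.log (Q p) - Real.log (gaussDens n (p.1 - p.2 + √t • z))|
        ≤ Q p * ((K + L) * ((1 + ‖p.1‖) ^ 2 * (1 + ‖p.2‖) ^ 2 * (1 + ‖z‖) ^ 2)) := by gcongr
      _ = (K + L) * (1 + ‖z‖) ^ 2 * (Q p * ((1 + ‖p.1‖) ^ 2 * (1 + ‖p.2‖) ^ 2)) := by ring
      _ ≤ (K + L) * (1 + ‖z‖) ^ 2 * (C * (wt (n + 1) p.1 * wt (n + 1) p.2)) :=
          mul_le_mul_of_nonneg_left (hQC p) (by positivity)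
      _ = _ := by ring
  have hGΨ : Integrable (fun w => G (Ψ w)) ((stdG n).prod volume) :=
    hΨm.integrable_comp_of_integrable hGi
  have hshear : ∫ w, G (Ψ w) ∂(stdG n).prod volume = ∫ w, G w ∂(stdG n).prod volume := by
    have := integral_map hΨm.measurable.aemeasurable (f := G)
      (by rw [hΨm.map_eq]; exact hGi.aestronglyMeasurable)
    rw [hΨm.map_eq] at this
    exact this.symm
  have hinner : ∀ p : Eucl n × Eucl n, ∫ z, G (z, p) ∂stdG n
      = Q p * (Real.log (Q p) - Real.log (gaussDens n (p.1 - p.2)))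
        + t / 2 * (∫ z, ‖z‖ ^ 2 ∂stdG n) * Q p := fun p => by
    simp only [hG]
    rw [integral_log_gaussDens_add ht.1]
    ring
  calc _ ≤ ∫ p : Eucl n × Eucl n, ∫ z, G (Ψ (z, p)) ∂stdG n := by
        refine integral_mono (hQ.smear ht.2).integrable_entropy hGΨ.integral_prod_right
          fun p => (hQ.smear_entropy_slice ht.2 p _).trans_eq ?_
        refine integral_congr_ae (ae_of_all _ fun z => ?_)
        have e : p + (0, √t • z) = (p.1, p.2 + √t • z) := by ext <;> simp
        simp only [hG, hΨ, e]
        rw [show p.1 - (p.2 + √t • z) + √t • z = p.1 - p.2 by abel]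
    _ = ∫ p : Eucl n × Eucl n, ∫ z, G (z, p) ∂stdG n := by
        rw [← integral_prod_symm _ hGΨ, hshear, integral_prod_symm _ hGi]
    _ = _ := by
        simp_rw [hinner]
        rw [integral_add hQ.integrable_entropy (hQ.integrable.const_mul _), integral_const_mul]

/-- The density of the Schrödinger coupling with potentials `f` and `g`. -/
def schrodingerKernel (f g : Eucl n → ℝ) (p : Eucl n × Eucl n) : ℝ :=
  f p.1 * gaussDens n (p.1 - p.2) * g p.2

lemma gHeat_one_eq (w : Eucl n → ℝ) (x : Eucl n) :
    gHeat 1 w x = ∫ y, w y * gaussDens n (x - y) := by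
  rw [← heat_eq_gHeat zero_le_one, heat, if_neg one_ne_zero]
  simp only [mul_one, gaussDens, mul_div_assoc]

lemma goodKernel_schrodinger (f g : SchwartzMap (Eucl n) ℝ) (hf : GaussLower f)
    (hg : GaussLower g) : GoodKernel (schrodingerKernel f g) := by
  have hp : ∀ p : Eucl n × Eucl n, 0 < f p.1 * gaussDens n (p.1 - p.2) := fun p =>
    mul_pos (hf.pos _) (gaussDens_pos n _)
  refine ⟨?_, fun p => mul_pos (hp p) (hg.pos _), fun N => ?_, ?_⟩
  · exact ((f.continuous.comp continuous_fst).mul ((continuous_gaussDens n).comp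
      (by fun_prop))).mul (g.continuous.comp continuous_snd)
  · obtain ⟨C, hC, h⟩ := schwartz_decay f N
    obtain ⟨D, hD, h'⟩ := schwartz_decay g N
    have h0 := gaussDens_pos n 0
    refine ⟨C * gaussDens n 0 * D, by positivity, fun p => ?_⟩
    have hw := (wt_pos N p.1).le
    calc f p.1 * gaussDens n (p.1 - p.2) * g p.2
        ≤ (C * wt N p.1 * gaussDens n 0) * (D * wt N p.2) := by
          refine mul_le_mul (mul_le_mul ((le_abs_self _).trans (h p.1)) (gaussDens_le n _)
            (gaussDens_pos n _).le (by positivity)) ((le_abs_self _).trans (h' p.2))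
            (hg.pos _).le (by positivity)
      _ = _ := by ring
  · obtain ⟨K, hK, h⟩ := (quadGrowth_log f hf).2
    obtain ⟨L, hL, h'⟩ := (quadGrowth_log g hg).2
    obtain ⟨M, hM, hM'⟩ := abs_log_gaussDens_le n
    refine ⟨K + M + L, by positivity, fun p => ?_⟩
    have e1 : (1 : ℝ) ≤ (1 + ‖p.1‖) ^ 2 := one_le_pow₀ (by linarith [norm_nonneg p.1])
    have e2 : (1 : ℝ) ≤ (1 + ‖p.2‖) ^ 2 := one_le_pow₀ (by linarith [norm_nonneg p.2])
    rw [schrodingerKernel, Real.log_mul (hp p).ne' (hg.pos _).ne',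
      Real.log_mul (hf.pos _).ne' (gaussDens_pos n _).ne', add_mul, add_mul]
    refine (abs_add_three _ _ _).trans (add_le_add (add_le_add ((h _).trans ?_)
      ((hM' _).trans ?_)) ((h' _).trans ?_))
    · exact mul_le_mul_of_nonneg_left (le_mul_of_one_le_right (by positivity) e2) hK
    · exact mul_le_mul_of_nonneg_left (one_add_norm_sub_le p) hM
    · exact mul_le_mul_of_nonneg_left (le_mul_of_one_le_left (by positivity) e1) hL

lemma lintegral_mul_gaussDens (w : SchwartzMap (Eucl n) ℝ) (hw : ∀ x, 0 < w x) {a : ℝ}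
    (ha : 0 ≤ a) (x : Eucl n) :
    ∫⁻ y, ENNReal.ofReal (a * (w y * gaussDens n (x - y)))
      = ENNReal.ofReal (a * gHeat 1 w x) := by
  have hc : Continuous fun y => gaussDens n (x - y) := (continuous_gaussDens n).comp (by fun_prop)
  have hi : Integrable fun y => w y * gaussDens n (x - y) :=
    w.integrable.mul_bdd (c := gaussDens n 0) hc.aestronglyMeasurable (ae_of_all _ fun y => by
      rw [Real.norm_of_nonneg (gaussDens_pos n _).le]; exact gaussDens_le n _)
  rw [gHeat_one_eq, ← integral_const_mul, ofReal_integral_eq_lintegral_ofReal (hi.const_mul a)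
    (ae_of_all _ fun y => mul_nonneg ha (mul_pos (hw y) (gaussDens_pos n _)).le)]

lemma gaussDens_sub_comm (x y : Eucl n) : gaussDens n (x - y) = gaussDens n (y - x) := by
  rw [gaussDens, gaussDens, norm_sub_rev]

lemma lintegral_schrodinger_right (f g : SchwartzMap (Eucl n) ℝ) (hf : ∀ x, 0 < f x)
    (hg : ∀ x, 0 < g x) (x : Eucl n) :
    ∫⁻ y, ENNReal.ofReal (schrodingerKernel f g (x, y))
      = ENNReal.ofReal (f x * gHeat 1 g x) := by
  rw [← lintegral_mul_gaussDens g hg (hf x).le]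
  refine lintegral_congr fun y => ?_
  rw [schrodingerKernel]
  congr 1
  ring

lemma lintegral_schrodinger_left (f g : SchwartzMap (Eucl n) ℝ) (hf : ∀ x, 0 < f x)
    (hg : ∀ x, 0 < g x) (y : Eucl n) :
    ∫⁻ x, ENNReal.ofReal (schrodingerKernel f g (x, y))
      = ENNReal.ofReal (g y * gHeat 1 f y) := by
  rw [← lintegral_mul_gaussDens f hf (hg y).le]
  refine lintegral_congr fun x => ?_
  rw [schrodingerKernel, gaussDens_sub_comm]
  congr 1
  ring

/-- Integrating a sum of functions of each variable against a coupling. -/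
lemma integral_coupling {π : Measure (Eucl n × Eucl n)} {u w a b : Eucl n → ℝ}
    (hπ : Coupling π (densMeas n u) (densMeas n w)) (hu : Measurable u) (hw : Measurable w)
    (hu0 : ∀ x, 0 ≤ u x) (hw0 : ∀ x, 0 ≤ w x) (hau : Integrable fun x => u x * a x)
    (hbw : Integrable fun x => w x * b x) :
    Integrable (fun p => a p.1 + b p.2) π ∧
      ∫ p, (a p.1 + b p.2) ∂π = (∫ x, u x * a x) + ∫ x, w x * b x := by
  have ha := integrable_densMeas hu hu0 hau
  have hb := integrable_densMeas hw hw0 hbw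
  rw [← integral_densMeas hu hu0, ← integral_densMeas hw hw0]
  rw [← hπ.2.1] at ha ⊢
  rw [← hπ.2.2] at hb ⊢
  have ha' : Integrable (fun p : Eucl n × Eucl n => a p.1) π := ha.comp_measurable measurable_fst
  have hb' : Integrable (fun p : Eucl n × Eucl n => b p.2) π := hb.comp_measurable measurable_snd
  exact ⟨ha'.add hb', by
    rw [integral_add ha' hb', integral_map measurable_fst.aemeasurable ha.aestronglyMeasurable,
      integral_map measurable_snd.aemeasurable hb.aestronglyMeasurable]⟩

lemma sigmaFinite_R01 (n : ℕ) : SigmaFinite (R01 n) := SigmaFinite.withDensity_ofReal _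

section Cost

variable {f g u v : SchwartzMap (Eucl n) ℝ}

lemma coupling_smear (hf : GaussLower f) (hg : GaussLower g)
    (hu : ∀ x, u x = f x * gHeat 1 g x) (hv : ∀ x, v x = g x * gHeat 1 f x)
    (hup : IsProbabilityMeasure (densMeas n u)) (hv0 : ∀ x, 0 < v x) {t : ℝ} (ht : t ≤ 1) :
    Coupling (volume.withDensity fun p =>
      ENNReal.ofReal (smear t (schrodingerKernel f g) p)) (densMeas n u)
      (densMeas n (gHeat t v)) := by
  have hQ := goodKernel_schrodinger f g hf hg
  refine coupling_withDensity (hQ.smear ht).cont.measurable hup (fun x => ?_) fun y => ?_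
  · rw [hQ.lintegral_smear_right, lintegral_schrodinger_right f g hf.pos hg.pos, hu]
  · rw [hQ.lintegral_smear_left]
    simp_rw [lintegral_schrodinger_left f g hf.pos hg.pos, ← hv]
    exact (ofReal_integral_eq_lintegral_ofReal (integrable_schwartz_comp_stdG v t y)
      (ae_of_all _ fun z => (hv0 _).le)).symm

lemma coupling_schrodinger (hf : GaussLower f) (hg : GaussLower g)
    (hu : ∀ x, u x = f x * gHeat 1 g x) (hv : ∀ x, v x = g x * gHeat 1 f x)
    (hup : IsProbabilityMeasure (densMeas n u)) :
    Coupling (volume.withDensity fun p => ENNReal.ofReal (schrodingerKernel f g p))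
      (densMeas n u) (densMeas n v) :=
  coupling_withDensity (goodKernel_schrodinger f g hf hg).cont.measurable hup
    (fun x => by rw [lintegral_schrodinger_right f g hf.pos hg.pos, hu])
    (fun y => by rw [lintegral_schrodinger_left f g hf.pos hg.pos, hv])

/-- Duality lower bound: every coupling has at least the entropy given by the potentials. -/
lemma le_relEnt_of_coupling (hf : GaussLower f) (hg : GaussLower g)
    (hu : ∀ x, u x = f x * gHeat 1 g x) (hv : ∀ x, v x = g x * gHeat 1 f x)
    (hup : IsProbabilityMeasure (densMeas n u)) (hu0 : ∀ x, 0 < u x)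
    {w : SchwartzMap (Eucl n) ℝ} (hw0 : ∀ x, 0 < w x)
    {π : Measure (Eucl n × Eucl n)} (hπ : Coupling π (densMeas n u) (densMeas n w)) :
    (((∫ x, u x * Real.log (f x)) + ∫ x, w x * Real.log (g x) : ℝ) : EReal)
      ≤ relEnt π (R01 n) := by
  rw [relEnt]
  split_ifs with h
  · have := hπ.1
    have := sigmaFinite_R01 n
    obtain ⟨hi, he⟩ := integral_coupling hπ u.continuous.measurable w.continuous.measurable
      (fun x => (hu0 x).le) (fun x => (hw0 x).le)
      ((rapidDecay_schwartz u).mul_quadGrowth (quadGrowth_log f hf)).integrable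
      ((rapidDecay_schwartz w).mul_quadGrowth (quadGrowth_log g hg)).integrable
    have hl : ∀ p : Eucl n × Eucl n,
        Real.log (f p.1 * g p.2) = Real.log (f p.1) + Real.log (g p.2) := fun p =>
      Real.log_mul (hf.pos _).ne' (hg.pos _).ne'
    have hkm : Measurable fun p : Eucl n × Eucl n => f p.1 * g p.2 :=
      ((f.continuous.comp continuous_fst).mul (g.continuous.comp continuous_snd)).measurable
    have hdm : Measurable fun p : Eucl n × Eucl n => gaussDens n (p.1 - p.2) :=
      ((continuous_gaussDens n).comp (by fun_prop)).measurable
    have hk1 : ∫⁻ p, ENNReal.ofReal (f p.1 * g p.2) ∂(R01 n) ≤ 1 := by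
      refine (lintegral_withDensity_eq_lintegral_mul _ hdm.ennreal_ofReal
        hkm.ennreal_ofReal).trans_le ?_
      have := (coupling_schrodinger hf hg hu hv hup).1.measure_univ
      rw [withDensity_apply _ MeasurableSet.univ, setLIntegral_univ] at this
      refine (lintegral_congr fun p => ?_).trans_le this.le
      rw [Pi.mul_apply, ← ENNReal.ofReal_mul (gaussDens_pos n _).le, schrodingerKernel]
      congr 1
      ring
    rw [EReal.coe_le_coe_iff, ← he]
    simp_rw [← hl] at hi ⊢
    exact integral_log_le_of_lintegral_le_one π (R01 n) h.1 hkm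
      (fun p => mul_pos (hf.pos _) (hg.pos _)) hk1 hi h.2
  · exact le_top

/-- The smeared Schrödinger coupling gives an upper bound of first order in time. -/
lemma relEnt_smear_le (hf : GaussLower f) (hg : GaussLower g)
    (hu : ∀ x, u x = f x * gHeat 1 g x) (hv : ∀ x, v x = g x * gHeat 1 f x)
    (hup : IsProbabilityMeasure (densMeas n u)) (hu0 : ∀ x, 0 < u x) (hv0 : ∀ x, 0 < v x)
    {t : ℝ} (ht : t ∈ Icc (0 : ℝ) 1) :
    relEnt (volume.withDensity fun p => ENNReal.ofReal (smear t (schrodingerKernel f g) p))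
      (R01 n) ≤ (((∫ x, u x * Real.log (f x)) + (∫ x, v x * Real.log (g x))
        + t / 2 * ∫ z, ‖z‖ ^ 2 ∂stdG n : ℝ) : EReal) := by
  have hQ := goodKernel_schrodinger f g hf hg
  have hS := hQ.smear ht.2
  have hdm : Measurable fun p : Eucl n × Eucl n => gaussDens n (p.1 - p.2) :=
    ((continuous_gaussDens n).comp (by fun_prop)).measurable
  have hlog : ∀ p : Eucl n × Eucl n,
      Real.log (smear t (schrodingerKernel f g) p / gaussDens n (p.1 - p.2))
        = Real.log (smear t (schrodingerKernel f g) p) - Real.log (gaussDens n (p.1 - p.2)) :=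
    fun p => Real.log_div (hS.pos p).ne' (gaussDens_pos n _).ne'
  have hπ := coupling_schrodinger hf hg hu hv hup
  obtain ⟨-, he⟩ := integral_coupling hπ u.continuous.measurable v.continuous.measurable
    (fun x => (hu0 x).le) (fun x => (hv0 x).le)
    ((rapidDecay_schwartz u).mul_quadGrowth (quadGrowth_log f hf)).integrable
    ((rapidDecay_schwartz v).mul_quadGrowth (quadGrowth_log g hg)).integrable
  have hdens : ∀ h : Eucl n × Eucl n → ℝ,
      ∫ p, h p ∂(volume.withDensity fun p => ENNReal.ofReal (schrodingerKernel f g p))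
        = ∫ p, schrodingerKernel f g p * h p := fun h => by
    rw [integral_withDensity_eq_integral_toReal_smul hQ.cont.measurable.ennreal_ofReal
      (ae_of_all _ fun x => ENNReal.ofReal_lt_top)]
    simp only [ENNReal.toReal_ofReal (hQ.pos _).le, smul_eq_mul]
  have hmass : ∫ p, schrodingerKernel f g p = 1 := by
    have := hπ.1
    have h1 := hdens fun _ => 1
    simpa using h1.symm
  have hpot : ∀ p : Eucl n × Eucl n, Real.log (schrodingerKernel f g p)
      - Real.log (gaussDens n (p.1 - p.2)) = Real.log (f p.1) + Real.log (g p.2) := fun p => by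
    have h1 := (hf.pos p.1).ne'
    have h2 := (gaussDens_pos n (p.1 - p.2)).ne'
    rw [schrodingerKernel, Real.log_mul (mul_ne_zero h1 h2) (hg.pos _).ne', Real.log_mul h1 h2]
    ring
  have hmain := hQ.smear_entropy_le ht
  simp_rw [hpot] at hmain
  rw [← hdens, he, hmass, mul_one] at hmain
  have hrel := relEnt_withDensity (volume : Measure (Eucl n × Eucl n)) hdm hS.cont.measurable
    (fun p => gaussDens_pos n _) hS.pos (by simpa only [hlog] using hS.integrable_entropy)
  refine (hrel.trans_le ?_)
  rw [EReal.coe_le_coe_iff]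
  simpa only [hlog] using hmain

lemma entCost_eq_of_iInf {u w : Eucl n → ℝ} (hu : Measurable u) (hw : Measurable w)
    (hu0 : ∀ x, 0 ≤ u x) (hw0 : ∀ x, 0 ≤ w x) {r : ℝ}
    (hr : (⨅ π : {π : Measure (Eucl n × Eucl n) // Coupling π (densMeas n u) (densMeas n w)},
      relEnt π.1 (R01 n)) = (r : EReal)) :
    entCost n (densMeas n u) (densMeas n w) = r - (entDens n u + entDens n w) / 2 := by
  rw [entCost, entCostE, hr, entLeb_densMeas hu hu0, entLeb_densMeas hw hw0, ← EReal.coe_sub,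
    EReal.toReal_coe]

/-- Two-sided bound for the entropic cost along the heat flow of the second marginal. -/
lemma entCost_heat_bounds (hf : GaussLower f) (hg : GaussLower g)
    (hu : ∀ x, u x = f x * gHeat 1 g x) (hv : ∀ x, v x = g x * gHeat 1 f x)
    (hup : IsProbabilityMeasure (densMeas n u)) (hu0 : ∀ x, 0 < u x) (hv0 : GaussLower v)
    {t : ℝ} (ht : t ∈ Icc (0 : ℝ) 1) :
    (∫ x, u x * Real.log (f x)) + (∫ x, gHeat t v x * Real.log (g x))
        - (entDens n u + entDens n (gHeat t v)) / 2
      ≤ entCost n (densMeas n u) (densMeas n (gHeat t v)) ∧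
    entCost n (densMeas n u) (densMeas n (gHeat t v))
      ≤ (∫ x, u x * Real.log (f x)) + (∫ x, v x * Real.log (g x))
        + t / 2 * (∫ z, ‖z‖ ^ 2 ∂stdG n) - (entDens n u + entDens n (gHeat t v)) / 2 := by
  obtain ⟨w, hw⟩ := exists_schwartz_gHeat ht.2 v
  obtain ⟨β, b, -, hb, hlow⟩ := gHeat_gaussLower v hv0
  have hw0 : ∀ x, 0 < w x := fun x => by
    rw [hw]; exact lt_of_lt_of_le (by positivity) (hlow t ht.2 x)
  have hc := coupling_smear hf hg hu hv hup hv0.pos ht.2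
  rw [← hw] at hc ⊢
  set I := ⨅ π : {π : Measure (Eucl n × Eucl n) // Coupling π (densMeas n u) (densMeas n w)},
      relEnt π.1 (R01 n) with hI
  have hlb : (((∫ x, u x * Real.log (f x)) + ∫ x, w x * Real.log (g x) : ℝ) : EReal) ≤ I :=
    le_iInf fun π => le_relEnt_of_coupling hf hg hu hv hup hu0 hw0 π.2
  have hub : I ≤ (((∫ x, u x * Real.log (f x)) + (∫ x, v x * Real.log (g x))
        + t / 2 * ∫ z, ‖z‖ ^ 2 ∂stdG n : ℝ) : EReal) :=
    (iInf_le _ ⟨_, hc⟩).trans (relEnt_smear_le hf hg hu hv hup hu0 hv0.pos ht)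
  have hr : I = (I.toReal : EReal) := (EReal.coe_toReal
    (ne_top_of_le_ne_top (EReal.coe_ne_top _) hub)
    (ne_bot_of_le_ne_bot (EReal.coe_ne_bot _) hlb)).symm
  rw [hr, EReal.coe_le_coe_iff] at hlb hub
  rw [entCost_eq_of_iInf u.continuous.measurable w.continuous.measurable (fun x => (hu0 x).le)
    (fun x => (hw0 x).le) (hI ▸ hr)]
  exact ⟨by linarith, by linarith⟩

/-- The lower derivative bound, in terms of Schwartz potentials. -/
lemma le_liminf_entCost {F G : SchwartzMap (Eucl n) ℝ} (hf : GaussLower f) (hg : GaussLower g)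
    (hF : ⇑F = gHeat 1 f) (hG : ⇑G = gHeat 1 g) (hu : ∀ x, u x = f x * G x)
    (hv : ∀ x, v x = g x * F x) (hup : IsProbabilityMeasure (densMeas n u)) :
    -(1 / 2) * derivWithin (fun s => entDens n (entInterp n f g s)) (Icc 0 1) 1
      ≤ liminf (fun t => (entCost n (densMeas n u) (densMeas n (gHeat t v))
            - entCost n (densMeas n u) (densMeas n v)) / t) (𝓝[>] 0) := by
  have hFl : GaussLower F := by
    obtain ⟨α, c, hα, hc, h⟩ := gHeat_gaussLower f hf
    exact ⟨α, c, hα, hc, by rw [hF]; exact h 1 le_rfl⟩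
  have hGl : GaussLower G := by
    obtain ⟨α, c, hα, hc, h⟩ := gHeat_gaussLower g hg
    exact ⟨α, c, hα, hc, by rw [hG]; exact h 1 le_rfl⟩
  have hu0 : ∀ x, 0 < u x := fun x => by rw [hu]; exact mul_pos (hf.pos x) (hGl.pos x)
  have hvl : GaussLower v := by
    have := hg.mul hFl
    simp_rw [← hv] at this
    exact this
  have hlg := quadGrowth_log g hg
  have hb := fun t (ht : t ∈ Icc (0 : ℝ) 1) => entCost_heat_bounds hf hg
    (by simpa only [← hG] using hu) (by simpa only [← hF] using hv) hup hu0 hvl ht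
  have hH := hasDerivWithinAt_Ioi_zero_iff.1 (hasDerivWithinAt_entDens_gHeat v hvl)
  have hW := tendsto_integral_gHeat_sub_mul_div v hlg
  have h0 := hb 0 (by simp)
  rw [gHeat_zero] at h0 hH
  set e0 := entCost n (densMeas n u) (densMeas n v)
  have hlow := hW.sub (hH.const_mul (1 / 2))
  have hup' := (tendsto_const_nhds (x := (1 / 2 * ∫ z : Eucl n, ‖z‖ ^ 2 ∂stdG n))).sub
    (hH.const_mul (1 / 2))
  have hd : -(1 / 2) * derivWithin (fun s => entDens n (entInterp n f g s)) (Icc 0 1) 1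
      = (∫ x, gen v x * Real.log (g x)) - 1 / 2 * ∫ x, (1 + Real.log (v x)) * gen v x := by
    rw [derivWithin_entInterp f g F hf hg hF, gen_identity g F v hg.pos hFl.pos hv hlg
      (quadGrowth_log F hFl)]
    simp_rw [hv, mul_comm (g _) (F _)]
    ring
  rw [hd, ← hlow.liminf_eq]
  refine liminf_le_liminf ?_ hlow.isBoundedUnder_ge
    (IsBoundedUnder.isCoboundedUnder_ge (hup'.isBoundedUnder_le.mono_le ?_))
  · filter_upwards [Ioc_zero_one_mem] with t ht
    have h := (hb t ⟨ht.1.le, ht.2⟩).1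
    obtain ⟨w, hw⟩ := exists_schwartz_gHeat ht.2 v
    have i1 : Integrable fun x => gHeat t v x * Real.log (g x) := by
      rw [← hw]
      exact ((rapidDecay_schwartz w).mul_quadGrowth hlg).integrable
    have hsub : ∫ x, (gHeat t v x - v x) * Real.log (g x)
        = (∫ x, gHeat t v x * Real.log (g x)) - ∫ x, v x * Real.log (g x) := by
      rw [← integral_sub i1 ((rapidDecay_schwartz v).mul_quadGrowth hlg).integrable]
      simp_rw [sub_mul]
    rw [hsub, ← mul_div_assoc, ← sub_div]
    refine div_le_div_of_nonneg_right ?_ ht.1.le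
    linarith [h0.2]
  · filter_upwards [Ioc_zero_one_mem] with t ht
    have h := (hb t ⟨ht.1.le, ht.2⟩).2
    rw [← mul_div_assoc, div_le_iff₀ ht.1, sub_mul, div_mul_cancel₀ _ ht.1.ne']
    linarith [h0.1]

end Cost

end

end HeatFlow

/-- Lower bound on the lower right derivative of the entropic cost along the heat flow. -/
theorem entropic_cost_lower_derivative
    (n : ℕ) (hn : 1 ≤ n) (u v f g : Eucl n → ℝ)
    (hu : IsProbabilityMeasure (densMeas n u)) (hv : IsProbabilityMeasure (densMeas n v))
    (hf : IsSchwartz n f) (hg : IsSchwartz n g)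
    (hfpos : ∀ x, 0 < f x) (hgpos : ∀ x, 0 < g x)
    (hlb : ∃ α c : ℝ, 0 < α ∧ 0 < c ∧ (∀ x, c * Real.exp (-α * ‖x‖ ^ 2) ≤ f x) ∧
      (∀ x, c * Real.exp (-α * ‖x‖ ^ 2) ≤ g x))
    (hdecu : ∀ x, u x = f x * heat n 1 g x) (hdecv : ∀ x, v x = g x * heat n 1 f x) :
    -(1 / 2) * derivWithin (fun s => entDens n (entInterp n f g s)) (Set.Icc 0 1) 1
      ≤ Filter.liminf (fun t =>
          (entCost n (densMeas n u) (densMeas n (heat n t v))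
            - entCost n (densMeas n u) (densMeas n v)) / t)
        (nhdsWithin 0 (Set.Ioi 0)) := by
  obtain ⟨f, rfl⟩ := hf
  obtain ⟨g, rfl⟩ := hg
  obtain ⟨α, c, hα, hc, hlf, hlg⟩ := hlb
  obtain ⟨F, hF⟩ := HeatFlow.exists_schwartz_gHeat le_rfl f
  obtain ⟨G, hG⟩ := HeatFlow.exists_schwartz_gHeat le_rfl g
  obtain ⟨U, hU⟩ := HeatFlow.exists_schwartz_mul f G
  obtain ⟨V, hV⟩ := HeatFlow.exists_schwartz_mul g F
  obtain rfl : u = ⇑U := funext fun x => by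
    rw [hdecu, hU, hG, HeatFlow.heat_eq_gHeat zero_le_one]
  obtain rfl : v = ⇑V := funext fun x => by
    rw [hdecv, hV, hF, HeatFlow.heat_eq_gHeat zero_le_one]
  refine (HeatFlow.le_liminf_entCost ⟨α, c, hα, hc, hlf⟩ ⟨α, c, hα, hc, hlg⟩ hF hG hU hV
    hu).trans_eq (liminf_congr ?_)
  filter_upwards [self_mem_nhdsWithin] with t ht
  rw [funext fun x => HeatFlow.heat_eq_gHeat (le_of_lt ht) V x]
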